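/- arXiv:2410.20795 — 3 statements merged into one kernel-verified Lean document; each statement's English description precedes it below -/
import Mathlib

section
/- Let a > 0 and ξ ∈ ℂ. The function G_ξ(z) := E_{a,1}(−ξ z^a) is holomorphic on the right half-plane {z ∈ ℂ : Re z > 0}, and for every z with Re z > 0 its derivative is given by d/dz G_ξ(z) = −ξ z^{a−1} E_{a,a}(−ξ z^a). -/
/-- The Mittag–Leffler function `E_{a,b}(z) = ∑_{k=0}^∞ z^k / Γ(ka + b)`. -/
noncomputable def mittagLeffler (a b : ℝ) (z : ℂ) : ℂ :=
  ∑' k : ℕ, z ^ k / (Real.Gamma (k * a + b) : ℂ)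

/-- Exponential lower bound for the Gamma function, at an arbitrary base `M`. -/
lemma rpow_mul_exp_neg_le_Gamma {M x : ℝ} (hM : 0 < M) (hx : 1 ≤ x) :
    M ^ (x - 1) * Real.exp (-M) ≤ Real.Gamma x := by
  have hint := Real.GammaIntegral_convergent (zero_lt_one.trans_le hx)
  have hsub : Set.Ioi M ⊆ Set.Ioi 0 := Set.Ioi_subset_Ioi hM.le
  rw [Real.Gamma_eq_integral (zero_lt_one.trans_le hx), ← integral_exp_neg_Ioi M,
    ← MeasureTheory.integral_const_mul]
  calc ∫ t in Set.Ioi M, M ^ (x - 1) * Real.exp (-t)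
      ≤ ∫ t in Set.Ioi M, Real.exp (-t) * t ^ (x - 1) := by
        refine MeasureTheory.setIntegral_mono_on ?_ (hint.mono_set hsub) measurableSet_Ioi ?_
        · exact (integrableOn_exp_neg_Ioi M).const_mul _
        · intro t ht
          rw [mul_comm]
          have : M ^ (x - 1) ≤ t ^ (x - 1) :=
            Real.rpow_le_rpow hM.le (le_of_lt ht) (by linarith)
          gcongr
    _ ≤ ∫ t in Set.Ioi 0, Real.exp (-t) * t ^ (x - 1) := by
        refine MeasureTheory.setIntegral_mono_set hint ?_ hsub.eventuallyLE
        filter_upwards [MeasureTheory.ae_restrict_mem measurableSet_Ioi] with t ht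
        have : (0 : ℝ) < t := ht
        positivity

lemma summable_pow_div_Gamma {a b R : ℝ} (ha : 0 < a) (hb : 0 < b) (hR : 0 < R) :
    Summable fun k : ℕ => R ^ k / Real.Gamma (k * a + b) := by
  set M : ℝ := (2 * R) ^ a⁻¹
  have hM : 0 < M := by positivity
  have hMa : M ^ a = 2 * R := Real.rpow_inv_rpow (by positivity) ha.ne'
  have hgeom : Summable fun k : ℕ =>
      (M ^ (b - 1) * Real.exp (-M))⁻¹ * (1 / 2 : ℝ) ^ k :=
    summable_geometric_two.mul_left _
  refine hgeom.of_norm_bounded_eventually_nat ?_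
  filter_upwards [Filter.eventually_ge_atTop ⌈a⁻¹⌉₊] with k hk
  have hka : 1 ≤ k * a := by
    have := (Nat.le_ceil a⁻¹).trans (Nat.cast_le.mpr hk)
    rwa [inv_le_iff_one_le_mul₀ ha] at this
  have hG : 0 < Real.Gamma (k * a + b) := Real.Gamma_pos_of_pos (by linarith)
  have hle := rpow_mul_exp_neg_le_Gamma (x := k * a + b) hM (by linarith)
  have hpow : M ^ (k * a + b - 1) = (2 * R) ^ k * M ^ (b - 1) := by
    rw [add_sub_assoc, Real.rpow_add hM, mul_comm (k : ℝ) a, Real.rpow_mul hM.le, hMa,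
      Real.rpow_natCast]
  rw [hpow] at hle
  rw [Real.norm_of_nonneg (by positivity)]
  calc R ^ k / Real.Gamma (k * a + b)
      ≤ R ^ k / ((2 * R) ^ k * M ^ (b - 1) * Real.exp (-M)) := by gcongr
    _ = (M ^ (b - 1) * Real.exp (-M))⁻¹ * (1 / 2 : ℝ) ^ k := by
        rw [mul_pow, one_div, inv_pow]
        field_simp

lemma succ_div_Gamma {a : ℝ} (ha : 0 < a) (k : ℕ) :
    ((k + 1 : ℕ) : ℝ) / Real.Gamma ((k + 1 : ℕ) * a + 1) =
      a⁻¹ / Real.Gamma (k * a + a) := by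
  have hpos : 0 < (k : ℝ) * a + a := by positivity
  have hG := (Real.Gamma_pos_of_pos hpos).ne'
  have h : ((k + 1 : ℕ) : ℝ) * a = k * a + a := by push_cast; ring
  rw [h, Real.Gamma_add_one hpos.ne', ← h]
  rw [← h] at hG
  have hk : ((k + 1 : ℕ) : ℝ) ≠ 0 := by positivity
  field_simp

/-- The derivative of `E_{a,1}` is `a⁻¹ E_{a,a}`. -/
theorem hasDerivAt_mittagLeffler_one {a : ℝ} (ha : 0 < a) (z : ℂ) :
    HasDerivAt (mittagLeffler a 1) ((a : ℂ)⁻¹ * mittagLeffler a a z) z := by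
  set R : ℝ := ‖z‖ + 1 with hRdef
  have hR : 0 < R := by positivity
  have hsum : Summable fun k : ℕ => k * R ^ (k - 1) / Real.Gamma (k * a + 1) := by
    rw [← summable_nat_add_iff 1]
    refine ((summable_pow_div_Gamma ha ha hR).mul_left a⁻¹).congr fun k => ?_
    rw [mul_div_right_comm, succ_div_Gamma ha, Nat.add_sub_cancel]
    ring
  have hz : z ∈ Metric.ball (0 : ℂ) R := by simp [hRdef]
  have hbound : ∀ (k : ℕ) (w : ℂ), w ∈ Metric.ball (0 : ℂ) R →
      ‖(k : ℂ) * w ^ (k - 1) / (Real.Gamma (k * a + 1) : ℂ)‖ ≤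
        k * R ^ (k - 1) / Real.Gamma (k * a + 1) := by
    intro k w hw
    have hG : 0 < Real.Gamma (k * a + 1) := Real.Gamma_pos_of_pos (by positivity)
    have hw' : ‖w‖ ≤ R := (mem_ball_zero_iff.mp hw).le
    rw [norm_div, norm_mul, norm_pow, Complex.norm_natCast, Complex.norm_real,
      Real.norm_of_nonneg hG.le]
    gcongr
  have hderiv := hasDerivAt_tsum_of_isPreconnected hsum Metric.isOpen_ball
    (convex_ball (0 : ℂ) R).isPreconnected
    (g := fun (k : ℕ) (w : ℂ) => w ^ k / (Real.Gamma (k * a + 1) : ℂ))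
    (fun k w _ => (hasDerivAt_pow k w).div_const _) hbound
    (Metric.mem_ball_self hR)
    (summable_of_ne_finset_zero (s := {0}) fun k hk => by
      simp [Finset.notMem_singleton.mp hk]) hz
  refine hderiv.congr_deriv ?_
  have hsum' : Summable fun k : ℕ =>
      (k : ℂ) * z ^ (k - 1) / (Real.Gamma (k * a + 1) : ℂ) :=
    hsum.of_norm_bounded fun k => hbound k z hz
  rw [hsum'.tsum_eq_zero_add, mittagLeffler, ← tsum_mul_left]
  simp only [Nat.cast_zero, zero_mul, zero_div, zero_add]
  refine tsum_congr fun k => ?_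
  have h := congrArg (fun x : ℝ => (x : ℂ)) (succ_div_Gamma ha k)
  simp only [Complex.ofReal_div, Complex.ofReal_inv, Complex.ofReal_natCast] at h
  rw [mul_div_right_comm, h, Nat.add_sub_cancel]
  ring

/-- For `a > 0` and `ξ ∈ ℂ`, the function `G_ξ(z) = E_{a,1}(-ξ z^a)` is holomorphic on the
right half-plane, with derivative `-ξ z^{a-1} E_{a,a}(-ξ z^a)` there. Here `z^a` is the
principal branch of the complex power. -/
theorem mittagLeffler_comp_cpow_hasDerivAt (a : ℝ) (ha : 0 < a) (ξ : ℂ) :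
    DifferentiableOn ℂ (fun z : ℂ => mittagLeffler a 1 (-ξ * z ^ (a : ℂ)))
      {z : ℂ | 0 < z.re} ∧
    ∀ z : ℂ, 0 < z.re →
      HasDerivAt (fun w : ℂ => mittagLeffler a 1 (-ξ * w ^ (a : ℂ)))
        (-ξ * z ^ ((a : ℂ) - 1) * mittagLeffler a a (-ξ * z ^ (a : ℂ))) z := by
  have hder : ∀ z : ℂ, 0 < z.re →
      HasDerivAt (fun w : ℂ => mittagLeffler a 1 (-ξ * w ^ (a : ℂ)))
        (-ξ * z ^ ((a : ℂ) - 1) * mittagLeffler a a (-ξ * z ^ (a : ℂ))) z := by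
    intro z hz
    have hpow : HasDerivAt (fun w : ℂ => -ξ * w ^ (a : ℂ)) _ z :=
      ((hasDerivAt_id z).cpow_const (c := (a : ℂ)) (Or.inl hz)).const_mul (-ξ)
    refine ((hasDerivAt_mittagLeffler_one ha _).comp z hpow).congr_deriv ?_
    have hac : (a : ℂ) ≠ 0 := Complex.ofReal_ne_zero.mpr ha.ne'
    simp only [id]
    field_simp
  exact ⟨fun z hz => (hder z hz).differentiableAt.differentiableWithinAt, hder⟩
end

section
/- Suppose 0 < a < 2, b > 0 and πa/2 < μ < min{π, πa}. Then there exists a constant C > 0 such that |E_{a,b}(z)| ≤ C / (1 + |z|) for every z ∈ ℂ with z ≠ 0 and μ ≤ |arg(z)| ≤ π. -/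
open Complex MeasureTheory Set Filter
open scoped Topology FourierTransform

theorem exists_rpow_le_mul_Gamma {c : ℝ} (hc : 0 < c) :
    ∃ M > 0, ∀ x : ℝ, 0 < x → c ^ x ≤ M * Real.Gamma x := by
  refine ⟨(c + 1) * Real.exp (c + 1), by positivity, fun x hx ↦ ?_⟩
  have hint := Real.GammaIntegral_convergent hx
  have hsub : Ioc c (c + 1) ⊆ Ioi 0 := fun t ht ↦ hc.trans ht.1
  have h1 : ∫ _ in Ioc c (c + 1), Real.exp (-(c + 1)) * (c ^ x / (c + 1)) ≤
      ∫ t in Ioc c (c + 1), Real.exp (-t) * t ^ (x - 1) := by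
    refine setIntegral_mono_on (integrableOn_const measure_Ioc_lt_top.ne)
      (hint.mono_set hsub) measurableSet_Ioc fun t ht ↦ ?_
    have ht0 : 0 < t := hc.trans ht.1
    rw [Real.rpow_sub_one ht0.ne']
    gcongr
    · exact ht.2
    · exact ht.1.le
    · exact ht.2
  have h2 : ∫ t in Ioc c (c + 1), Real.exp (-t) * t ^ (x - 1) ≤ Real.Gamma x := by
    rw [Real.Gamma_eq_integral hx]
    refine setIntegral_mono_set hint ?_ hsub.eventuallyLE
    filter_upwards [ae_restrict_mem measurableSet_Ioi] with t (ht : 0 < t)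
    simp only [Pi.zero_apply]
    positivity
  have h3 := h1.trans h2
  simp only [setIntegral_const, smul_eq_mul, Measure.real, Real.volume_Ioc] at h3
  rw [add_sub_cancel_left, ENNReal.toReal_ofReal zero_le_one, one_mul, Real.exp_neg] at h3
  calc c ^ x = (c + 1) * Real.exp (c + 1) * ((Real.exp (c + 1))⁻¹ * (c ^ x / (c + 1))) := by
        field_simp
    _ ≤ _ := by gcongr

theorem exists_summable_bound_mittagLeffler {a b : ℝ} (ha : 0 < a) (hb : 0 < b) (R : ℝ) :
    ∃ u : ℕ → ℝ, Summable u ∧ ∀ (k : ℕ) (z : ℂ), ‖z‖ ≤ R →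
      ‖z ^ k / (Real.Gamma (k * a + b) : ℂ)‖ ≤ u k := by
  wlog hR : 0 < R generalizing R
  · obtain ⟨u, hu, h⟩ := this 1 one_pos
    exact ⟨u, hu, fun k z hz ↦ h k z (by linarith)⟩
  set c : ℝ := (2 * R) ^ (1 / a)
  have hc : 0 < c := by positivity
  obtain ⟨M, hM, h⟩ := exists_rpow_le_mul_Gamma hc
  refine ⟨fun k ↦ M / c ^ b * (1 / 2) ^ k, summable_geometric_two.mul_left _, fun k z hz ↦ ?_⟩
  have hx : 0 < k * a + b := by positivity
  have hΓ := Real.Gamma_pos_of_pos hx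
  have hcx : c ^ (k * a + b) = (2 * R) ^ k * c ^ b := by
    rw [Real.rpow_add hc, ← Real.rpow_mul (by positivity), ← Real.rpow_natCast]
    congr 2
    field_simp
  have h1 := h _ hx
  rw [hcx] at h1
  rw [norm_div, norm_pow, norm_real, Real.norm_of_nonneg hΓ.le, div_le_iff₀ hΓ]
  calc ‖z‖ ^ k ≤ R ^ k := by gcongr
    _ = (1 / 2) ^ k / c ^ b * ((2 * R) ^ k * c ^ b) := by
        rw [mul_pow, one_div, inv_pow]
        field_simp
    _ ≤ (1 / 2) ^ k / c ^ b * (M * Real.Gamma (k * a + b)) := by gcongr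
    _ = _ := by ring

theorem hasSum_mittagLeffler {a b : ℝ} (ha : 0 < a) (hb : 0 < b) (z : ℂ) :
    HasSum (fun k : ℕ ↦ z ^ k / (Real.Gamma (k * a + b) : ℂ)) (mittagLeffler a b z) := by
  obtain ⟨u, hu, h⟩ := exists_summable_bound_mittagLeffler ha hb ‖z‖
  exact (hu.of_norm_bounded fun k ↦ h k z le_rfl).hasSum

theorem differentiable_mittagLeffler {a b : ℝ} (ha : 0 < a) (hb : 0 < b) :
    Differentiable ℂ (mittagLeffler a b) := by
  intro z
  obtain ⟨u, hu, h⟩ := exists_summable_bound_mittagLeffler ha hb (‖z‖ + 1)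
  have hd : DifferentiableOn ℂ (mittagLeffler a b) (Metric.ball 0 (‖z‖ + 1)) :=
    differentiableOn_tsum_of_summable_norm hu (fun k ↦ by fun_prop) Metric.isOpen_ball
      fun k w hw ↦ h k w (mem_ball_zero_iff.1 hw).le
  exact hd.differentiableAt (Metric.isOpen_ball.mem_nhds (by simp))

theorem mittagLeffler_eq_add_deriv {a b : ℝ} (ha : 0 < a) (hb : 0 < b) (z : ℂ) :
    mittagLeffler a b z =
      b * mittagLeffler a (b + 1) z + a * z * deriv (mittagLeffler a (b + 1)) z := by
  have hb1 : 0 < b + 1 := by positivity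
  obtain ⟨u, hu, h⟩ := exists_summable_bound_mittagLeffler ha hb1 (‖z‖ + 1)
  have hd := hasSum_deriv_of_summable_norm (z := z)
    (F := fun (k : ℕ) (w : ℂ) ↦ w ^ k / (Real.Gamma (k * a + (b + 1)) : ℂ))
    hu (fun k ↦ Differentiable.differentiableOn (by fun_prop))
    (Metric.isOpen_ball (x := 0) (ε := ‖z‖ + 1))
    (fun k w hw ↦ h k w (mem_ball_zero_iff.1 hw).le) (by simp)
  refine (hasSum_mittagLeffler ha hb z).unique ?_
  convert! ((hasSum_mittagLeffler ha hb1 z).mul_left (b : ℂ)).add (hd.mul_left (a * z)) using 1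
  funext k
  have hx : 0 < k * a + b := by positivity
  have hΓ : (Real.Gamma (k * a + b) : ℂ) ≠ 0 := by
    exact_mod_cast (Real.Gamma_pos_of_pos hx).ne'
  have hx' : ((k : ℂ) * a + b) ≠ 0 := by exact_mod_cast hx.ne'
  rw [← add_assoc, Real.Gamma_add_one hx.ne', deriv_div_const, deriv_pow_field]
  push_cast
  rcases k with _ | k
  · have hb' : (b : ℂ) ≠ 0 := by exact_mod_cast hb.ne'
    simp
    field_simp
  · simp only [Nat.add_sub_cancel, pow_succ]
    field_simp
    push_cast
    ring

theorem integrableOn_cpow_mul_exp_neg_mul_Ioi {x : ℝ} (hx : 0 < x) {s : ℂ} (hs : 0 < s.re) :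
    IntegrableOn (fun t : ℝ ↦ (t : ℂ) ^ ((x : ℂ) - 1) * exp (-(s * t))) (Ioi 0) := by
  have h : IntegrableOn (fun t : ℝ ↦ t ^ (x - 1) * Real.exp (-s.re * t ^ (1 : ℝ))) (Ioi 0) :=
    integrableOn_rpow_mul_exp_neg_mul_rpow (by linarith) one_pos hs
  refine Integrable.mono' h ?_ ?_
  · refine ContinuousOn.aestronglyMeasurable (fun t (ht : 0 < t) ↦ ?_) measurableSet_Ioi
    have : ContinuousAt (fun t : ℝ ↦ (t : ℂ) ^ ((x : ℂ) - 1)) t :=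
      continuousAt_ofReal_cpow_const _ _ (Or.inr ht.ne')
    exact (this.mul (by fun_prop)).continuousWithinAt
  · filter_upwards [ae_restrict_mem measurableSet_Ioi] with t (ht : 0 < t)
    rw [norm_mul, norm_cpow_eq_rpow_re_of_pos ht, norm_exp]
    simp

theorem analyticOnNhd_integral_cpow_mul_exp_neg_mul {x : ℝ} (hx : 0 < x) :
    AnalyticOnNhd ℂ (fun s : ℂ ↦ ∫ t : ℝ in Ioi 0, (t : ℂ) ^ ((x : ℂ) - 1) * exp (-(s * t)))
      {s | 0 < s.re} := by
  refine DifferentiableOn.analyticOnNhd (fun s (hs : 0 < s.re) ↦ ?_)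
    (isOpen_Ioi.preimage continuous_re)
  have hx1 : 0 < x + 1 := by linarith
  have hderiv (w : ℂ) (t : ℝ) (ht : 0 < t) :
      HasDerivAt (fun s : ℂ ↦ (t : ℂ) ^ ((x : ℂ) - 1) * exp (-(s * t)))
        (-((t : ℂ) ^ (((x + 1 : ℝ) : ℂ) - 1) * exp (-(w * t)))) w := by
    have h := ((((hasDerivAt_id w).mul_const (t : ℂ)).neg).cexp).const_mul
      ((t : ℂ) ^ ((x : ℂ) - 1))
    refine h.congr_deriv ?_
    have ht' : (t : ℂ) ≠ 0 := by exact_mod_cast ht.ne'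
    have : ((x + 1 : ℝ) : ℂ) - 1 = (x : ℂ) - 1 + 1 := by push_cast; ring
    rw [this, cpow_add _ _ ht', cpow_one]
    simp
    ring
  have hre : 0 < ((s.re / 2 : ℝ) : ℂ).re := by simpa using hs
  refine (hasDerivAt_integral_of_dominated_loc_of_deriv_le (μ := volume.restrict (Ioi 0))
    (F := fun (s : ℂ) (t : ℝ) ↦ (t : ℂ) ^ ((x : ℂ) - 1) * exp (-(s * t)))
    (F' := fun (s : ℂ) (t : ℝ) ↦ -((t : ℂ) ^ (((x + 1 : ℝ) : ℂ) - 1) * exp (-(s * t))))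
    (bound := fun t : ℝ ↦ ‖(t : ℂ) ^ (((x + 1 : ℝ) : ℂ) - 1) * exp (-((s.re / 2 : ℝ) * t))‖)
    (s := {w | s.re / 2 < w.re})
    ((isOpen_Ioi.preimage continuous_re).mem_nhds (by simpa using hs)) ?_
    (integrableOn_cpow_mul_exp_neg_mul_Ioi hx hs)
    (integrableOn_cpow_mul_exp_neg_mul_Ioi hx1 hs).neg.aestronglyMeasurable ?_
    (integrableOn_cpow_mul_exp_neg_mul_Ioi hx1 hre).norm
    ?_).2.differentiableAt.differentiableWithinAt
  · filter_upwards [(isOpen_Ioi.preimage continuous_re).mem_nhds hs] with w hw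
    exact (integrableOn_cpow_mul_exp_neg_mul_Ioi hx hw).aestronglyMeasurable
  · filter_upwards [ae_restrict_mem measurableSet_Ioi] with t (ht : 0 < t) w (hw : s.re / 2 < w.re)
    rw [norm_neg, norm_mul, norm_mul, norm_exp, norm_exp]
    refine mul_le_mul_of_nonneg_left (Real.exp_le_exp.2 ?_) (norm_nonneg _)
    simp only [neg_re, mul_re, ofReal_re, ofReal_im, mul_zero, sub_zero]
    nlinarith
  · filter_upwards [ae_restrict_mem measurableSet_Ioi] with t (ht : 0 < t) w _
    exact hderiv w t ht

/-- The Laplace transform of `t ^ (x - 1)` at a complex frequency. -/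
theorem integral_cpow_mul_exp_neg_mul_Ioi_of_re_pos {x : ℝ} (hx : 0 < x) {s : ℂ}
    (hs : 0 < s.re) :
    ∫ t : ℝ in Ioi 0, (t : ℂ) ^ ((x : ℂ) - 1) * exp (-(s * t)) = s ^ (-(x : ℂ)) * Real.Gamma x := by
  have hanalytic : AnalyticOnNhd ℂ (fun s : ℂ ↦ s ^ (-(x : ℂ)) * Real.Gamma x) {s | 0 < s.re} :=
    fun s hs ↦ (analyticAt_id.cpow analyticAt_const (Or.inl hs)).mul analyticAt_const
  refine (analyticOnNhd_integral_cpow_mul_exp_neg_mul hx).eqOn_of_preconnected_of_frequently_eq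
    hanalytic (convex_halfSpace_re_gt 0).isPreconnected (z₀ := ((1 : ℝ) : ℂ)) (by simp) ?_ hs
  have htendsto : Tendsto ((↑) : ℝ → ℂ) (𝓝[≠] 1) (𝓝[≠] ((1 : ℝ) : ℂ)) :=
    continuous_ofReal.continuousAt.continuousWithinAt.tendsto_nhdsWithin
      fun t ht h ↦ ht (ofReal_injective h)
  refine htendsto.frequently (Eventually.frequently ?_)
  filter_upwards [nhdsWithin_le_nhds (lt_mem_nhds one_pos)] with r hr
  rw [integral_cpow_mul_exp_neg_mul_Ioi (by simpa using hx) hr, one_div,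
    inv_cpow_ofReal_nonneg hr.le, cpow_neg, Gamma_ofReal]

/-- Parametrization of the line `re s = 1`. -/
noncomputable def unitLine (ξ : ℝ) : ℂ := 1 + 2 * Real.pi * ξ * I

theorem unitLine_re (ξ : ℝ) : (unitLine ξ).re = 1 := by simp [unitLine]

theorem unitLine_mem_slitPlane (ξ : ℝ) : unitLine ξ ∈ slitPlane :=
  Or.inl (by simp [unitLine_re])

theorem unitLine_ne_zero (ξ : ℝ) : unitLine ξ ≠ 0 := slitPlane_ne_zero (unitLine_mem_slitPlane ξ)

theorem one_le_norm_unitLine (ξ : ℝ) : 1 ≤ ‖unitLine ξ‖ := by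
  simpa [unitLine_re] using re_le_norm (unitLine ξ)

theorem continuous_unitLine : Continuous unitLine := by
  unfold unitLine
  fun_prop

theorem continuous_unitLine_cpow (r : ℝ) : Continuous fun ξ ↦ unitLine ξ ^ (r : ℂ) :=
  continuous_unitLine.cpow continuous_const unitLine_mem_slitPlane

theorem integrable_norm_unitLine_rpow {r : ℝ} (hr : r < -1) :
    Integrable fun ξ ↦ ‖unitLine ξ‖ ^ r := by
  have hfin : (Module.finrank ℝ ℝ : ℝ) < -r := by simp; linarith
  refine (integrable_rpow_neg_one_add_norm_sq (μ := volume) hfin).mono' ?_ ?_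
  · exact (continuous_unitLine.norm.rpow_const
      fun ξ ↦ Or.inl (norm_ne_zero_iff.2 (unitLine_ne_zero ξ))).aestronglyMeasurable
  · refine .of_forall fun ξ ↦ ?_
    have h : 1 + ‖ξ‖ ^ 2 ≤ ‖unitLine ξ‖ ^ 2 := by
      rw [Complex.sq_norm, normSq_apply, Real.norm_eq_abs, sq_abs]
      simp only [unitLine, add_re, one_re, mul_re, re_ofNat, ofReal_re, im_ofNat, ofReal_im,
        mul_zero, sub_zero, mul_im, zero_mul, add_zero, I_re, I_im, mul_one, sub_self, add_im,
        one_im, zero_add]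
      nlinarith [Real.pi_gt_three, sq_nonneg ξ, mul_nonneg (sq_nonneg ξ)
        (by nlinarith [Real.pi_gt_three] : 0 ≤ 4 * Real.pi ^ 2 - 1)]
    rw [Real.norm_of_nonneg (by positivity), neg_neg]
    calc ‖unitLine ξ‖ ^ r = (‖unitLine ξ‖ ^ 2) ^ (r / 2) := by
          rw [← Real.rpow_natCast, ← Real.rpow_mul (norm_nonneg _)]
          congr 1
          push_cast
          ring
      _ ≤ _ := Real.rpow_le_rpow_of_nonpos (by positivity) h (by linarith)

/-- Laplace inversion formula for the reciprocal of the Gamma function. -/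
theorem integral_exp_mul_unitLine_cpow {x : ℝ} (hx : 1 < x) :
    ∫ ξ, exp (unitLine ξ) * unitLine ξ ^ (-(x : ℂ)) = 1 / (Real.Gamma x : ℂ) := by
  have hx0 : 0 < x := by linarith
  have hΓ : (Real.Gamma x : ℂ) ≠ 0 := by exact_mod_cast (Real.Gamma_pos_of_pos hx0).ne'
  set f : ℝ → ℂ := (Ioi 0).indicator fun t : ℝ ↦ (t : ℂ) ^ ((x : ℂ) - 1) * exp (-(1 * t)) with hf
  have hint : Integrable f := (integrable_indicator_iff measurableSet_Ioi).2
    (integrableOn_cpow_mul_exp_neg_mul_Ioi hx0 (by simp))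
  have hfourier : 𝓕 f = fun ξ ↦ unitLine ξ ^ (-(x : ℂ)) * Real.Gamma x := by
    funext ξ
    rw [Real.fourier_real_eq_integral_exp_smul,
      ← integral_cpow_mul_exp_neg_mul_Ioi_of_re_pos hx0 (by simp [unitLine_re]),
      ← integral_indicator measurableSet_Ioi]
    congr 1 with t
    by_cases ht : t ∈ Ioi 0
    · simp only [hf, indicator_of_mem ht, smul_eq_mul]
      rw [mul_left_comm, ← exp_add]
      congr 2
      simp only [unitLine]
      push_cast
      ring
    · simp [hf, indicator_of_notMem ht]
  have hfint : Integrable (𝓕 f) := by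
    rw [hfourier]
    refine Integrable.mul_const ?_ _
    refine (integrable_norm_unitLine_rpow (r := -x) (by linarith)).mono' ?_ ?_
    · simpa using (continuous_unitLine_cpow (-x)).aestronglyMeasurable
    · refine .of_forall fun ξ ↦ ?_
      rw [← ofReal_neg, norm_cpow_real]
  have hcont : ContinuousAt f 1 := by
    have : f =ᶠ[𝓝 1] fun t : ℝ ↦ (t : ℂ) ^ ((x : ℂ) - 1) * exp (-(1 * t)) := by
      filter_upwards [lt_mem_nhds one_pos] with t ht
      exact indicator_of_mem ht _
    refine ContinuousAt.congr ?_ this.symm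
    exact (continuousAt_ofReal_cpow_const _ _ (Or.inr one_ne_zero)).mul (by fun_prop)
  have h := hint.fourierInv_fourier_eq hfint hcont
  rw [Real.fourierInv_eq', hfourier] at h
  rw [eq_div_iff hΓ, ← integral_mul_const]
  have h1 : f 1 = exp (-1) := by simp [hf]
  rw [h1] at h
  have h2 := congrArg (exp 1 * ·) h
  simp only [← exp_add, add_neg_cancel, exp_zero, ← integral_const_mul] at h2
  rw [← h2]
  congr 1 with ξ
  simp only [smul_eq_mul]
  rw [mul_assoc, ← mul_assoc (exp 1), ← exp_add]
  congr 2
  simp [unitLine]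

theorem mul_norm_add_norm_le_norm_sub {κ κ₀ : ℝ} (hκ : |κ| ≤ 1) (hκ₀ : |κ₀| ≤ 1) {w z : ℂ}
    (hw : κ₀ * ‖w‖ ≤ w.re) (hz : z.re ≤ κ * ‖z‖) :
    (κ₀ - κ) * (‖w‖ + ‖z‖) ≤ 4 * ‖w - z‖ := by
  have h1 : w.re - z.re ≤ ‖w - z‖ := by simpa using re_le_norm (w - z)
  have h2 := abs_norm_sub_norm_le w z
  have h3 (c : ℝ) (hc : |c| ≤ 1) : -|‖w‖ - ‖z‖| ≤ c * (‖w‖ - ‖z‖) := by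
    refine le_trans ?_ (neg_abs_le _)
    rw [abs_mul]
    nlinarith [abs_nonneg (‖w‖ - ‖z‖)]
  linarith [h3 κ hκ, h3 κ₀ hκ₀]

theorem cos_mul_norm_unitLine_cpow_le_re {a : ℝ} (ha0 : 0 < a) (ha2 : a < 2) (ξ : ℝ) :
    Real.cos (Real.pi * a / 2) * ‖unitLine ξ ^ (a : ℂ)‖ ≤ (unitLine ξ ^ (a : ℂ)).re := by
  rw [norm_cpow_real, cpow_ofReal_re, mul_comm]
  have harg : |(unitLine ξ).arg| ≤ Real.pi / 2 :=
    abs_arg_le_pi_div_two_iff.2 (by simp [unitLine_re])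
  gcongr
  rw [← Real.cos_abs (arg _ * a), abs_mul, abs_of_pos ha0]
  refine Real.cos_le_cos_of_nonneg_of_le_pi (by positivity) ?_ ?_ <;>
  nlinarith [Real.pi_pos]

/-- The integrand of the contour integral on `re s = 1` representing `mittagLeffler a b z`. -/
noncomputable def mittagLefflerKernel (a b : ℝ) (z : ℂ) (ξ : ℝ) : ℂ :=
  exp (unitLine ξ) * unitLine ξ ^ ((a - b : ℝ) : ℂ) * (unitLine ξ ^ (a : ℂ) - z)⁻¹

theorem norm_exp_unitLine (ξ : ℝ) : ‖exp (unitLine ξ)‖ = Real.exp 1 := by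
  rw [norm_exp, unitLine_re]

theorem one_le_norm_unitLine_cpow {a : ℝ} (ha : 0 ≤ a) (ξ : ℝ) : 1 ≤ ‖unitLine ξ ^ (a : ℂ)‖ := by
  rw [norm_cpow_real]
  exact Real.one_le_rpow (one_le_norm_unitLine ξ) ha

theorem norm_mittagLefflerKernel_le {a b δ : ℝ} {z : ℂ} {ξ : ℝ} (hδ : 0 < δ)
    (h : δ ≤ ‖unitLine ξ ^ (a : ℂ) - z‖) :
    ‖mittagLefflerKernel a b z ξ‖ ≤ Real.exp 1 * ‖unitLine ξ‖ ^ (a - b) * δ⁻¹ := by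
  rw [mittagLefflerKernel, norm_mul, norm_mul, norm_exp_unitLine, norm_cpow_real, norm_inv]
  gcongr

theorem continuous_mittagLefflerKernel {a b : ℝ} {z : ℂ}
    (h : ∀ ξ, unitLine ξ ^ (a : ℂ) - z ≠ 0) : Continuous (mittagLefflerKernel a b z) :=
  (continuous_unitLine.cexp.mul (continuous_unitLine_cpow _)).mul
    (((continuous_unitLine_cpow a).sub continuous_const).inv₀ h)

theorem integrable_mittagLefflerKernel {a b δ : ℝ} (hab : a + 1 < b) (hδ : 0 < δ) {z : ℂ}
    (h : ∀ ξ, δ ≤ ‖unitLine ξ ^ (a : ℂ) - z‖) : Integrable (mittagLefflerKernel a b z) :=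
  (((integrable_norm_unitLine_rpow (r := a - b) (by linarith)).const_mul _).mul_const _).mono'
    (continuous_mittagLefflerKernel
      fun ξ ↦ norm_pos_iff.1 (hδ.trans_le (h ξ))).aestronglyMeasurable
    (.of_forall fun ξ ↦ norm_mittagLefflerKernel_le hδ (h ξ))

theorem le_norm_sub_of_mem_ball {δ : ℝ} {w z z₀ : ℂ} (h : δ ≤ ‖w - z₀‖)
    (hz : z ∈ Metric.ball z₀ (δ / 2)) : δ / 2 ≤ ‖w - z‖ := by
  have h1 := norm_sub_le_norm_sub_add_norm_sub w z z₀
  rw [mem_ball_iff_norm] at hz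
  linarith

theorem differentiableAt_integral_mittagLefflerKernel {a b δ : ℝ} (hab : a + 1 < b)
    (hδ : 0 < δ) {z₀ : ℂ} (h : ∀ ξ, δ ≤ ‖unitLine ξ ^ (a : ℂ) - z₀‖) :
    DifferentiableAt ℂ (fun z ↦ ∫ ξ, mittagLefflerKernel a b z ξ) z₀ := by
  have hball (ξ : ℝ) (z : ℂ) (hz : z ∈ Metric.ball z₀ (δ / 2)) :=
    le_norm_sub_of_mem_ball (h ξ) hz
  have hint := integrable_norm_unitLine_rpow (r := a - b) (by linarith)
  refine (hasDerivAt_integral_of_dominated_loc_of_deriv_le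
    (F' := fun z ξ ↦ mittagLefflerKernel a b z ξ * (unitLine ξ ^ (a : ℂ) - z)⁻¹)
    (bound := fun ξ ↦ Real.exp 1 * ‖unitLine ξ‖ ^ (a - b) * (δ / 2)⁻¹ * (δ / 2)⁻¹)
    (Metric.ball_mem_nhds z₀ (half_pos hδ)) ?_ (integrable_mittagLefflerKernel hab hδ h) ?_ ?_
    (((hint.const_mul _).mul_const _).mul_const _) ?_).2.differentiableAt
  · filter_upwards [Metric.ball_mem_nhds z₀ (half_pos hδ)] with z hz
    exact (integrable_mittagLefflerKernel hab (half_pos hδ)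
      fun ξ ↦ hball ξ z hz).aestronglyMeasurable
  · have hne ξ := norm_pos_iff.1 (hδ.trans_le (h ξ))
    exact ((continuous_mittagLefflerKernel hne).mul
      (((continuous_unitLine_cpow a).sub continuous_const).inv₀ hne)).aestronglyMeasurable
  · refine .of_forall fun ξ z hz ↦ ?_
    rw [norm_mul, norm_inv]
    gcongr
    · exact norm_mittagLefflerKernel_le (half_pos hδ) (hball ξ z hz)
    · exact hball ξ z hz
  · refine .of_forall fun ξ z hz ↦ ?_
    have hne := norm_pos_iff.1 ((half_pos hδ).trans_le (hball ξ z hz))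
    refine ((((hasDerivAt_id z).const_sub (unitLine ξ ^ (a : ℂ))).inv hne).const_mul
      (exp (unitLine ξ) * unitLine ξ ^ ((a - b : ℝ) : ℂ))).congr_deriv ?_
    simp only [mittagLefflerKernel, id]
    field_simp

theorem analyticAt_integral_mittagLefflerKernel {a b δ : ℝ} (hab : a + 1 < b)
    (hδ : 0 < δ) {z₀ : ℂ} (h : ∀ ξ, δ ≤ ‖unitLine ξ ^ (a : ℂ) - z₀‖) :
    AnalyticAt ℂ (fun z ↦ ∫ ξ, mittagLefflerKernel a b z ξ) z₀ := by
  refine DifferentiableOn.analyticAt (s := Metric.ball z₀ (δ / 2)) (fun z hz ↦ ?_)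
    (Metric.ball_mem_nhds z₀ (half_pos hδ))
  exact (differentiableAt_integral_mittagLefflerKernel hab (half_pos hδ)
    fun ξ ↦ le_norm_sub_of_mem_ball (h ξ) hz).differentiableWithinAt

theorem mittagLeffler_eq_integral_of_norm_lt_one {a b : ℝ} (ha : 0 < a) (hb : 1 < b) {z : ℂ}
    (hz : ‖z‖ < 1) : mittagLeffler a b z = ∫ ξ, mittagLefflerKernel a b z ξ := by
  set F : ℕ → ℝ → ℂ := fun k ξ ↦
    exp (unitLine ξ) * unitLine ξ ^ (-((k * a + b : ℝ) : ℂ)) * z ^ k with hF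
  have hnorm (k : ℕ) (ξ : ℝ) :
      ‖F k ξ‖ ≤ Real.exp 1 * ‖unitLine ξ‖ ^ (-b) * ‖z‖ ^ k := by
    simp only [hF]
    rw [norm_mul, norm_mul, norm_exp_unitLine, ← ofReal_neg, norm_cpow_real, norm_pow]
    gcongr
    · exact one_le_norm_unitLine ξ
    · have : 0 ≤ k * a := by positivity
      linarith
  have hdom := (integrable_norm_unitLine_rpow (r := -b) (by linarith)).const_mul (Real.exp 1)
  have hFint (k : ℕ) : Integrable (F k) := by
    refine (hdom.mul_const _).mono' (Continuous.aestronglyMeasurable ?_) (.of_forall (hnorm k))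
    simp only [hF, ← ofReal_neg]
    exact (continuous_unitLine.cexp.mul (continuous_unitLine_cpow _)).mul continuous_const
  have hsum : Summable fun k ↦ ∫ ξ, ‖F k ξ‖ := by
    refine ((summable_geometric_of_lt_one (norm_nonneg z) hz).mul_left
      (∫ ξ, Real.exp 1 * ‖unitLine ξ‖ ^ (-b))).of_nonneg_of_le
      (fun k ↦ integral_nonneg fun ξ ↦ norm_nonneg _) fun k ↦ ?_
    rw [← integral_mul_const]
    exact integral_mono (hFint k).norm (hdom.mul_const _) (hnorm k)
  have h := hasSum_integral_of_summable_integral_norm hFint hsum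
  have hval (k : ℕ) : ∫ ξ, F k ξ = z ^ k / (Real.Gamma (k * a + b) : ℂ) := by
    have : 0 ≤ k * a := by positivity
    rw [integral_mul_const, integral_exp_mul_unitLine_cpow (by linarith), one_div_mul_eq_div]
  simp only [hval] at h
  refine (hasSum_mittagLeffler ha (by linarith) z).unique ?_
  suffices hK : mittagLefflerKernel a b z = fun ξ ↦ ∑' k, F k ξ by rwa [hK]
  funext ξ
  set w := unitLine ξ ^ (a : ℂ) with hw
  have hwnorm : 1 ≤ ‖w‖ := one_le_norm_unitLine_cpow ha.le ξ
  have hw0 : w ≠ 0 := norm_pos_iff.1 (by linarith)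
  have hq : ‖z / w‖ < 1 := by
    rw [norm_div, div_lt_one (by linarith)]
    linarith
  have hterm (k : ℕ) : F k ξ = exp (unitLine ξ) * unitLine ξ ^ (-(b : ℂ)) * (z / w) ^ k := by
    have : -((k * a + b : ℝ) : ℂ) = -(b : ℂ) - k * (a : ℂ) := by push_cast; ring
    simp only [hF]
    rw [this, cpow_sub _ _ (unitLine_ne_zero ξ), cpow_nat_mul, div_pow]
    ring
  simp only [hterm]
  rw [tsum_mul_left, tsum_geometric_of_norm_lt_one hq, mittagLefflerKernel]
  have : ((a - b : ℝ) : ℂ) = -(b : ℂ) + a := by push_cast; ring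
  rw [this, cpow_add _ _ (unitLine_ne_zero ξ), ← hw]
  have h1 : w - z ≠ 0 := fun h ↦ by
    rw [sub_eq_zero.1 h] at hwnorm
    linarith
  have h2 : 1 - z / w = (w - z) / w := by field_simp
  rw [h2]
  field_simp

theorem mittagLeffler_eq_integral {a b κ : ℝ} (ha0 : 0 < a) (ha2 : a < 2) (hab : a + 1 < b)
    (hκ1 : -1 ≤ κ) (hκ : κ < Real.cos (Real.pi * a / 2)) {z : ℂ} (hz : z.re ≤ κ * ‖z‖) :
    mittagLeffler a b z = ∫ ξ, mittagLefflerKernel a b z ξ := by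
  have hU : IsPreconnected (segment ℝ 0 z) := (convex_segment 0 z).isPreconnected
  have hnear : mittagLeffler a b =ᶠ[𝓝 0] fun z ↦ ∫ ξ, mittagLefflerKernel a b z ξ := by
    filter_upwards [Metric.ball_mem_nhds 0 one_pos] with w hw
    exact mittagLeffler_eq_integral_of_norm_lt_one ha0 (by linarith) (mem_ball_zero_iff.1 hw)
  refine AnalyticOnNhd.eqOn_of_preconnected_of_eventuallyEq
    (fun w _ ↦ (differentiable_mittagLeffler ha0 (by linarith)).analyticAt w)
    (fun w hw ↦ ?_) hU (left_mem_segment ℝ 0 z) hnear (right_mem_segment ℝ 0 z)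
  rw [segment_eq_image] at hw
  obtain ⟨t, ht, rfl⟩ := hw
  have hcone : ((1 - t) • (0 : ℂ) + t • z).re ≤ κ * ‖(1 - t) • (0 : ℂ) + t • z‖ := by
    rw [smul_zero, zero_add, norm_smul, Real.norm_of_nonneg ht.1, real_smul, re_ofReal_mul]
    nlinarith [mul_le_mul_of_nonneg_left hz ht.1]
  refine analyticAt_integral_mittagLefflerKernel (δ := (Real.cos (Real.pi * a / 2) - κ) / 4) hab
    (by linarith) fun ξ ↦ ?_
  have hκabs : |κ| ≤ 1 := abs_le.2 ⟨hκ1, hκ.le.trans (Real.cos_le_one _)⟩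
  have h := mul_norm_add_norm_le_norm_sub hκabs (Real.abs_cos_le_one _)
    (cos_mul_norm_unitLine_cpow_le_re ha0 ha2 ξ) hcone
  have h1 := one_le_norm_unitLine_cpow ha0.le ξ
  nlinarith [norm_nonneg ((1 - t) • (0 : ℂ) + t • z)]

/-- Decay of the Mittag–Leffler function in the cones `re z ≤ κ ‖z‖`. -/
def MittagLefflerDecay (a b : ℝ) : Prop :=
  ∀ κ : ℝ, -1 ≤ κ → κ < Real.cos (Real.pi * a / 2) → ∃ C > 0, ∀ z : ℂ, z.re ≤ κ * ‖z‖ →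
    ‖mittagLeffler a b z‖ ≤ C / (1 + ‖z‖)

theorem mittagLefflerDecay_of_add_one_lt {a b : ℝ} (ha0 : 0 < a) (ha2 : a < 2)
    (hab : a + 1 < b) : MittagLefflerDecay a b := by
  intro κ hκ1 hκ
  set d := Real.cos (Real.pi * a / 2) - κ
  have hd : 0 < d := sub_pos.2 hκ
  have hint := integrable_norm_unitLine_rpow (r := a - b) (by linarith)
  set J := ∫ ξ, ‖unitLine ξ‖ ^ (a - b)
  have hJ : 0 ≤ J := integral_nonneg fun ξ ↦ by positivity
  refine ⟨Real.exp 1 * (J + 1) * (4 / d), by positivity, fun z hz ↦ ?_⟩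
  have hκabs : |κ| ≤ 1 := abs_le.2 ⟨hκ1, hκ.le.trans (Real.cos_le_one _)⟩
  have hlower (ξ : ℝ) : d * (1 + ‖z‖) / 4 ≤ ‖unitLine ξ ^ (a : ℂ) - z‖ := by
    have h := mul_norm_add_norm_le_norm_sub hκabs (Real.abs_cos_le_one _)
      (cos_mul_norm_unitLine_cpow_le_re ha0 ha2 ξ) hz
    have h1 := one_le_norm_unitLine_cpow ha0.le ξ
    have h2 : d * (1 + ‖z‖) ≤ d * (‖unitLine ξ ^ (a : ℂ)‖ + ‖z‖) := by gcongr
    linarith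
  have hpos : 0 < d * (1 + ‖z‖) / 4 := by positivity
  rw [mittagLeffler_eq_integral ha0 ha2 hab hκ1 hκ hz]
  calc ‖∫ ξ, mittagLefflerKernel a b z ξ‖
      ≤ ∫ ξ, Real.exp 1 * ‖unitLine ξ‖ ^ (a - b) * (d * (1 + ‖z‖) / 4)⁻¹ :=
        norm_integral_le_of_norm_le ((hint.const_mul _).mul_const _)
          (.of_forall fun ξ ↦ norm_mittagLefflerKernel_le hpos (hlower ξ))
    _ = Real.exp 1 * J * (d * (1 + ‖z‖) / 4)⁻¹ := by
        rw [integral_mul_const, integral_const_mul]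
    _ ≤ Real.exp 1 * (J + 1) * (d * (1 + ‖z‖) / 4)⁻¹ := by
        gcongr
        linarith
    _ = _ := by field_simp

theorem MittagLefflerDecay.of_add_one {a b : ℝ} (ha : 0 < a) (hb : 0 < b)
    (h : MittagLefflerDecay a (b + 1)) : MittagLefflerDecay a b := by
  intro κ hκ1 hκ
  have hcos := Real.cos_le_one (Real.pi * a / 2)
  set ε := (Real.cos (Real.pi * a / 2) - κ) / 8 with hε
  have hε0 : 0 < ε := by rw [hε]; linarith
  have hε1 : ε ≤ 1 / 4 := by rw [hε]; linarith
  obtain ⟨C, hC, hbound⟩ := h (κ + 4 * ε) (by linarith) (by rw [hε]; linarith)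
  refine ⟨b * C + a * (2 * C / ε), by positivity, fun z hz ↦ ?_⟩
  have hz' : ‖mittagLeffler a (b + 1) z‖ ≤ C / (1 + ‖z‖) :=
    hbound z (hz.trans (by gcongr; linarith))
  have hderiv : ‖z‖ * ‖deriv (mittagLeffler a (b + 1)) z‖ ≤ 2 * C / ε / (1 + ‖z‖) := by
    rcases eq_or_ne z 0 with rfl | hz0
    · simp only [norm_zero, zero_mul]
      positivity
    have hzpos : 0 < ‖z‖ := norm_pos_iff.2 hz0
    have hcauchy := norm_deriv_le_of_forall_mem_sphere_norm_le (c := z) (R := ε * ‖z‖)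
      (C := 2 * C / (1 + ‖z‖)) (by positivity)
      (differentiable_mittagLeffler ha (by linarith : 0 < b + 1)).diffContOnCl fun w hw ↦ by
        rw [mem_sphere_iff_norm] at hw
        have h1 : w.re - z.re ≤ ε * ‖z‖ := by simpa [hw] using re_le_norm (w - z)
        have h2 : |‖w‖ - ‖z‖| ≤ ε * ‖z‖ := hw ▸ abs_norm_sub_norm_le w z
        have h3 := abs_le.1 h2
        have hw2 : ‖z‖ ≤ 2 * ‖w‖ := by nlinarith
        have hcone : w.re ≤ (κ + 4 * ε) * ‖w‖ := by
          have : κ * (‖z‖ - ‖w‖) ≤ ε * ‖z‖ := by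
            refine (le_abs_self _).trans ?_
            rw [abs_mul, abs_sub_comm]
            have : |κ| ≤ 1 := abs_le.2 ⟨hκ1, by linarith⟩
            nlinarith [abs_nonneg (‖w‖ - ‖z‖)]
          nlinarith
        refine (hbound w hcone).trans ?_
        rw [div_le_div_iff₀ (by positivity) (by positivity)]
        nlinarith
    calc ‖z‖ * ‖deriv (mittagLeffler a (b + 1)) z‖
        ≤ ‖z‖ * (2 * C / (1 + ‖z‖) / (ε * ‖z‖)) := by gcongr
      _ = _ := by field_simp
  rw [mittagLeffler_eq_add_deriv ha hb]
  calc _ ≤ b * ‖mittagLeffler a (b + 1) z‖ +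
        a * (‖z‖ * ‖deriv (mittagLeffler a (b + 1)) z‖) := by
        refine (norm_add_le _ _).trans_eq ?_
        simp only [norm_mul, norm_real, Real.norm_of_nonneg ha.le, Real.norm_of_nonneg hb.le,
          mul_assoc]
    _ ≤ b * (C / (1 + ‖z‖)) + a * (2 * C / ε / (1 + ‖z‖)) := by gcongr
    _ = _ := by ring

theorem mittagLefflerDecay {a b : ℝ} (ha0 : 0 < a) (ha2 : a < 2) (hb : 0 < b) :
    MittagLefflerDecay a b := by
  have key (n : ℕ) : ∀ b : ℝ, 0 < b → a + 1 < b + n → MittagLefflerDecay a b := by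
    induction n with
    | zero => exact fun b _ h ↦ mittagLefflerDecay_of_add_one_lt ha0 ha2 (by simpa using h)
    | succ n ih =>
      refine fun b hb h ↦ (ih (b + 1) (by linarith) ?_).of_add_one ha0 hb
      push_cast at h
      linarith
  exact key 3 b hb (by push_cast; linarith)

/-- If `0 < a < 2`, `b > 0` and `πa/2 < μ < min{π, πa}`, then there is `C > 0` with
`|E_{a,b}(z)| ≤ C / (1 + |z|)` for all `z ≠ 0` with `μ ≤ |arg z| ≤ π`. -/
theorem mittagLeffler_bound_in_sector (a b mu : ℝ) (ha0 : 0 < a) (ha2 : a < 2) (hb : 0 < b)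
    (hmu1 : Real.pi * a / 2 < mu) (hmu2 : mu < min Real.pi (Real.pi * a)) :
    ∃ C > 0, ∀ z : ℂ, z ≠ 0 → mu ≤ |z.arg| → |z.arg| ≤ Real.pi →
      ‖mittagLeffler a b z‖ ≤ C / (1 + ‖z‖) := by
  have hmu0 : 0 ≤ Real.pi * a / 2 := by positivity
  obtain ⟨C, hC, h⟩ := mittagLefflerDecay ha0 ha2 hb (Real.cos mu) (Real.neg_one_le_cos mu)
    (Real.cos_lt_cos_of_nonneg_of_le_pi hmu0 (hmu2.le.trans (min_le_left _ _)) hmu1)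
  refine ⟨C, hC, fun z _ hz hz' ↦ h z ?_⟩
  rw [← norm_mul_cos_arg z, mul_comm, ← Real.cos_abs z.arg]
  gcongr
  exact Real.cos_le_cos_of_nonneg_of_le_pi (hmu0.trans hmu1.le) hz' hz
end

section
/- Suppose 0 < a < 1 and πa/2 < μ < πa. Then there exist constants C > 0 and R > 0 such that for every z ∈ ℂ with |z| ≥ R and μ ≤ |arg(z)| ≤ π one has |E_{a,1}(z) + z^{−1}/Γ(1 − a)| ≤ C |z|^{−2}; that is, E_{a,1}(z) = −z^{−1}/Γ(1 − a) + O(|z|^{−2}) as |z| → ∞ in the sector μ ≤ |arg(z)| ≤ π. -/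
namespace MittagLeffler

open Complex MeasureTheory Set Filter Topology

/-- The function `e^ζ ζ^b` in the logarithmic coordinate `ζ = e^w`. -/
noncomputable def hankelKernel (b : ℝ) (w : ℂ) : ℂ := cexp (cexp w + b * w)

lemma norm_hankelKernel (b x y : ℝ) :
    ‖hankelKernel b (x + y * I)‖ = Real.exp (Real.exp x * Real.cos y + b * x) := by
  simp [hankelKernel, Complex.norm_exp, Complex.exp_re]

lemma hankelKernel_add (b c : ℝ) (w : ℂ) :
    hankelKernel (b + c) w = hankelKernel b w * cexp (c * w) := by
  simp only [hankelKernel, ← Complex.exp_add]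
  push_cast
  ring_nf

lemma differentiable_hankelKernel (b : ℝ) : Differentiable ℂ (hankelKernel b) := by
  unfold hankelKernel
  fun_prop

lemma continuous_hankelKernel_line (b φ : ℝ) :
    Continuous fun x : ℝ => hankelKernel b (x + φ * I) :=
  (differentiable_hankelKernel b).continuous.comp (by fun_prop)

lemma integrable_exp_neg_mul_exp {κ b : ℝ} (hκ : 0 < κ) (hb : 0 < b) :
    Integrable fun x : ℝ => Real.exp (-κ * Real.exp x + b * x) := by
  have h := integrableOn_rpow_mul_exp_neg_mul_rpow (p := 1) (s := b - 1) (b := κ)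
    (by linarith) one_pos hκ
  have himg : Real.exp '' univ = Ioi 0 := by rw [image_univ, Real.range_exp]
  rw [← himg, integrableOn_image_iff_integrableOn_abs_deriv_smul MeasurableSet.univ
    (fun x _ => (Real.hasDerivAt_exp x).hasDerivWithinAt) Real.exp_injective.injOn,
    integrableOn_univ] at h
  refine h.congr (Eventually.of_forall fun x => ?_)
  simp only [abs_of_pos (Real.exp_pos x), smul_eq_mul, Real.rpow_one, ← Real.exp_mul,
    ← Real.exp_add]
  ring_nf

lemma tendsto_exp_neg_mul_exp_atTop {κ : ℝ} (hκ : 0 < κ) (b : ℝ) :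
    Tendsto (fun x : ℝ => Real.exp (-κ * Real.exp x + b * x)) atTop (𝓝 0) := by
  refine ((tendsto_rpow_mul_exp_neg_mul_atTop_nhds_zero b κ hκ).comp
    Real.tendsto_exp_atTop).congr fun x => ?_
  simp only [Function.comp_apply, ← Real.exp_mul, ← Real.exp_add]
  ring_nf

lemma tendsto_exp_mul_atBot {b : ℝ} (hb : 0 < b) :
    Tendsto (fun x : ℝ => Real.exp (b * x)) atBot (𝓝 0) :=
  Real.tendsto_exp_atBot.comp (tendsto_id.const_mul_atBot hb)

lemma norm_hankelKernel_le {κ φ : ℝ} (hφ : Real.cos φ ≤ -κ) (b x : ℝ) :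
    ‖hankelKernel b (x + φ * I)‖ ≤ Real.exp (-κ * Real.exp x + b * x) := by
  rw [norm_hankelKernel, Real.exp_le_exp]
  nlinarith [mul_le_mul_of_nonneg_left hφ (Real.exp_pos x).le]

lemma integrable_hankelKernel {φ b : ℝ} (hφ : Real.cos φ < 0) (hb : 0 < b) :
    Integrable fun x : ℝ => hankelKernel b (x + φ * I) :=
  (integrable_exp_neg_mul_exp (neg_pos.mpr hφ) hb).mono'
    (continuous_hankelKernel_line b φ).aestronglyMeasurable
    (Eventually.of_forall fun x => norm_hankelKernel_le (by simp) b x)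

lemma norm_hankelKernel_le_of_le {b c x : ℝ} (hbc : b ≤ c) (hx : 0 ≤ x) (y : ℝ) :
    ‖hankelKernel b (x + y * I)‖ ≤ ‖hankelKernel c (x + y * I)‖ := by
  simp only [norm_hankelKernel]
  gcongr

lemma integrableOn_hankelKernel {φ ρ : ℝ} (hφ : Real.cos φ < 0) (hρ : 0 ≤ ρ) (b : ℝ) :
    IntegrableOn (fun x : ℝ => hankelKernel b (x + φ * I)) (Ioi ρ) := by
  refine (integrable_hankelKernel (b := |b| + 1) hφ (by positivity)).integrableOn.norm.mono'
    (continuous_hankelKernel_line b φ).aestronglyMeasurable ?_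
  filter_upwards [ae_restrict_mem measurableSet_Ioi] with x hx
  exact norm_hankelKernel_le_of_le (by linarith [le_abs_self b]) (hρ.trans (le_of_lt hx)) φ

lemma tendsto_intervalIntegral_zero_of_norm_le {f : ℂ → ℂ} {g r : ℝ → ℝ} {φ ψ : ℝ}
    (hg : Tendsto g atTop (𝓝 0))
    (h : ∀ᶠ M in atTop, ∀ y ∈ uIcc φ ψ, ‖f (r M + y * I)‖ ≤ g M) :
    Tendsto (fun M : ℝ => ∫ y in φ..ψ, f (r M + y * I)) atTop (𝓝 0) := by
  refine squeeze_zero_norm' (a := fun M => g M * |ψ - φ|) ?_ (by simpa using hg.mul_const _)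
  filter_upwards [h] with M hM
  exact intervalIntegral.norm_integral_le_of_norm_le_const
    fun y hy => hM y (uIoc_subset_uIcc hy)

/-- The line integral of the Hankel kernel does not depend on the line. -/
lemma integral_hankelKernel_eq_of_cos_le {φ ψ κ b : ℝ} (hκ : 0 < κ) (hb : 0 < b)
    (h : ∀ y ∈ uIcc φ ψ, Real.cos y ≤ -κ) :
    ∫ x : ℝ, hankelKernel b (x + φ * I) = ∫ x : ℝ, hankelKernel b (x + ψ * I) := by
  have hcos : ∀ y ∈ uIcc φ ψ, Real.cos y < 0 := fun y hy => by linarith [h y hy]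
  have hline : ∀ y ∈ uIcc φ ψ, Tendsto (fun M : ℝ => ∫ x in -M..M, hankelKernel b (x + y * I))
      atTop (𝓝 (∫ x : ℝ, hankelKernel b (x + y * I))) := fun y hy =>
    intervalIntegral_tendsto_integral (integrable_hankelKernel (hcos y hy) hb)
      tendsto_neg_atTop_atBot tendsto_id
  have hright : Tendsto (fun M : ℝ => ∫ y in φ..ψ, hankelKernel b (M + y * I)) atTop (𝓝 0) :=
    tendsto_intervalIntegral_zero_of_norm_le (r := id) (tendsto_exp_neg_mul_exp_atTop hκ b)
      (Eventually.of_forall fun M y hy => norm_hankelKernel_le (h y hy) b M)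
  have hleft : Tendsto (fun M : ℝ => ∫ y in φ..ψ, hankelKernel b ((-M : ℝ) + y * I))
      atTop (𝓝 0) := by
    refine tendsto_intervalIntegral_zero_of_norm_le (r := fun M => -M)
      ((tendsto_exp_mul_atBot hb).comp tendsto_neg_atTop_atBot)
      (Eventually.of_forall fun M y hy => ?_)
    refine (norm_hankelKernel_le (h y hy) b (-M)).trans ?_
    simp only [Function.comp_apply]
    gcongr
    nlinarith [Real.exp_pos (-M)]
  have hrect : ∀ M : ℝ, (∫ x in -M..M, hankelKernel b (x + φ * I)) -
      (∫ x in -M..M, hankelKernel b (x + ψ * I)) +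
      I • (∫ y in φ..ψ, hankelKernel b (M + y * I)) -
      I • (∫ y in φ..ψ, hankelKernel b ((-M : ℝ) + y * I)) = 0 := fun M =>
    integral_boundary_rect_eq_zero_of_differentiableOn (hankelKernel b) ⟨-M, φ⟩ ⟨M, ψ⟩
      (differentiable_hankelKernel b).differentiableOn
  have hlim := (((hline φ left_mem_uIcc).sub (hline ψ right_mem_uIcc)).add
    (hright.const_smul I)).sub (hleft.const_smul I)
  simp only [hrect, smul_zero, add_zero, sub_zero] at hlim
  exact sub_eq_zero.mp (tendsto_nhds_unique hlim tendsto_const_nhds)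

lemma integral_hankelKernel_of_cos_eq_neg_one {b φ : ℝ} (hb : 0 < b) (hc : Real.cos φ = -1)
    (hs : Real.sin φ = 0) :
    ∫ x : ℝ, hankelKernel b (x + φ * I) = cexp (b * φ * I) * Real.Gamma b := by
  have himg : Real.exp '' univ = Ioi 0 := by rw [image_univ, Real.range_exp]
  have hφ : cexp (φ * I) = -1 := by
    rw [Complex.exp_mul_I, ← Complex.ofReal_cos, ← Complex.ofReal_sin, hc, hs]
    simp
  rw [Real.Gamma_eq_integral hb, ← himg,
    integral_image_eq_integral_abs_deriv_smul MeasurableSet.univ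
    (fun x _ => (Real.hasDerivAt_exp x).hasDerivWithinAt) Real.exp_injective.injOn,
    setIntegral_univ, ← integral_complex_ofReal, ← integral_const_mul]
  congr 1 with x
  rw [hankelKernel, Complex.exp_add x, hφ, abs_of_pos (Real.exp_pos x), smul_eq_mul,
    ← Real.exp_mul, ← Real.exp_add, ← Real.exp_add, Complex.ofReal_exp, ← Complex.exp_add]
  push_cast
  ring_nf

lemma integral_hankelKernel_upper {θ b : ℝ} (hθ : Real.pi / 2 < θ) (hθ' : θ ≤ Real.pi)
    (hb : 0 < b) :
    ∫ x : ℝ, hankelKernel b (x + θ * I) = cexp (b * Real.pi * I) * Real.Gamma b := by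
  have hκ : 0 < -Real.cos θ :=
    neg_pos.mpr (Real.cos_neg_of_pi_div_two_lt_of_lt hθ (by linarith [Real.pi_pos]))
  rw [integral_hankelKernel_eq_of_cos_le (ψ := Real.pi) hκ hb,
    integral_hankelKernel_of_cos_eq_neg_one hb (by simp) (by simp)]
  intro y hy
  rw [uIcc_of_le hθ'] at hy
  simpa using Real.cos_le_cos_of_nonneg_of_le_pi (by linarith [Real.pi_pos]) hy.2 hy.1

lemma integral_hankelKernel_lower {θ b : ℝ} (hθ : Real.pi / 2 < θ) (hθ' : θ ≤ Real.pi)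
    (hb : 0 < b) :
    ∫ x : ℝ, hankelKernel b (x + (-θ : ℝ) * I) = cexp (-(b * Real.pi * I)) * Real.Gamma b := by
  have hκ : 0 < -Real.cos θ :=
    neg_pos.mpr (Real.cos_neg_of_pi_div_two_lt_of_lt hθ (by linarith [Real.pi_pos]))
  rw [integral_hankelKernel_eq_of_cos_le (ψ := -Real.pi) hκ hb,
    integral_hankelKernel_of_cos_eq_neg_one hb (by simp) (by simp)]
  · push_cast
    ring_nf
  intro y hy
  rw [uIcc_of_ge (by linarith)] at hy
  rw [neg_neg, ← Real.cos_neg y]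
  exact Real.cos_le_cos_of_nonneg_of_le_pi (by linarith [Real.pi_pos]) (by linarith [hy.1])
    (by linarith [hy.2])

/-- The two boundary lines of the strip `|im w| ≤ θ` combine to the reciprocal Gamma function. -/
lemma integral_hankelKernel_sub {θ b : ℝ} (hθ : Real.pi / 2 < θ) (hθ' : θ ≤ Real.pi)
    (hb : 0 < b) (hb' : b < 1) :
    (∫ x : ℝ, hankelKernel b (x + θ * I)) - ∫ x : ℝ, hankelKernel b (x + (-θ : ℝ) * I) =
      2 * Real.pi * I * (Real.Gamma (1 - b) : ℂ)⁻¹ := by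
  have hsin : Real.sin (Real.pi * b) ≠ 0 :=
    (Real.sin_pos_of_pos_of_lt_pi (by positivity) (by nlinarith [Real.pi_pos])).ne'
  have hΓ : (Real.Gamma (1 - b) : ℂ) ≠ 0 :=
    ofReal_ne_zero.mpr (Real.Gamma_pos_of_pos (by linarith)).ne'
  have hrefl : (Real.Gamma b : ℂ) * Real.Gamma (1 - b) * Real.sin (Real.pi * b) = Real.pi := by
    have h := Real.Gamma_mul_Gamma_one_sub b
    rw [eq_div_iff hsin] at h
    exact_mod_cast h
  have hexp : cexp (b * Real.pi * I) - cexp (-(b * Real.pi * I)) =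
      2 * I * Real.sin (Real.pi * b) := by
    rw [← neg_mul, Complex.exp_mul_I, Complex.exp_mul_I, Complex.cos_neg, Complex.sin_neg]
    push_cast
    ring_nf
  rw [integral_hankelKernel_upper hθ hθ' hb, integral_hankelKernel_lower hθ hθ' hb, ← sub_mul,
    hexp, eq_mul_inv_iff_mul_eq₀ hΓ]
  linear_combination 2 * I * hrefl

/-- The integral of `f` along the boundary of the half-strip `re w ≥ ρ`, `|im w| ≤ θ`, which is
Hankel's contour in the coordinate `ζ = e^w`. -/
noncomputable def hankelIntegral (θ ρ : ℝ) (f : ℂ → ℂ) : ℂ :=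
  (∫ x : ℝ in Ioi ρ, f (x + θ * I)) - (∫ x : ℝ in Ioi ρ, f (x + (-θ : ℝ) * I)) +
    I * ∫ y : ℝ in (-θ)..θ, f (ρ + y * I)

lemma hankelIntegral_eq_of_norm_le {f : ℂ → ℂ} {θ ρ C c : ℝ} (hθ : 0 ≤ θ) (hc : 0 < c)
    (hf : ∀ w : ℂ, |w.im| ≤ θ → DifferentiableAt ℂ f w)
    (hbound : ∀ x y : ℝ, x ≤ ρ → |y| ≤ θ → ‖f (x + y * I)‖ ≤ C * Real.exp (c * x))
    (hup : Integrable fun x : ℝ => f (x + θ * I))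
    (hlow : Integrable fun x : ℝ => f (x + (-θ : ℝ) * I)) :
    hankelIntegral θ ρ f = (∫ x : ℝ, f (x + θ * I)) - ∫ x : ℝ, f (x + (-θ : ℝ) * I) := by
  have hleft : Tendsto (fun M : ℝ => ∫ y in (-θ)..θ, f ((-M : ℝ) + y * I)) atTop (𝓝 0) := by
    refine tendsto_intervalIntegral_zero_of_norm_le (r := fun M => -M)
      (g := fun M => C * Real.exp (c * -M)) ?_ ?_
    · simpa using ((tendsto_exp_mul_atBot hc).comp tendsto_neg_atTop_atBot).const_mul C
    · filter_upwards [eventually_ge_atTop (-ρ)] with M hM y hy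
      rw [uIcc_of_le (by linarith)] at hy
      exact hbound _ _ (by linarith) (abs_le.mpr hy)
  have hline : ∀ φ : ℝ, Integrable (fun x : ℝ => f (x + φ * I)) →
      Tendsto (fun M : ℝ => ∫ x in -M..ρ, f (x + φ * I)) atTop
        (𝓝 (∫ x in Iic ρ, f (x + φ * I))) := fun φ h =>
    intervalIntegral_tendsto_integral_Iic ρ h.integrableOn tendsto_neg_atTop_atBot
  have hrect : ∀ M : ℝ, (∫ x in -M..ρ, f (x + (-θ : ℝ) * I)) - (∫ x in -M..ρ, f (x + θ * I)) +
      I • (∫ y in (-θ)..θ, f (ρ + y * I)) - I • (∫ y in (-θ)..θ, f ((-M : ℝ) + y * I)) = 0 :=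
    fun M => by
      refine integral_boundary_rect_eq_zero_of_differentiableOn f ⟨-M, -θ⟩ ⟨ρ, θ⟩ fun w hw => ?_
      have him : w.im ∈ uIcc (-θ) θ := hw.2
      rw [uIcc_of_le (by linarith)] at him
      exact (hf w (abs_le.mpr him)).differentiableWithinAt
  have hlim := (((hline _ hlow).sub (hline _ hup)).add_const
    (I • ∫ y in (-θ)..θ, f (ρ + y * I))).sub (hleft.const_smul I)
  simp only [hrect, smul_zero, sub_zero] at hlim
  have hzero := tendsto_nhds_unique hlim tendsto_const_nhds
  have hsplit : ∀ φ : ℝ, Integrable (fun x : ℝ => f (x + φ * I)) → ∫ x : ℝ, f (x + φ * I) =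
      (∫ x in Iic ρ, f (x + φ * I)) + ∫ x in Ioi ρ, f (x + φ * I) := fun φ h =>
    (intervalIntegral.integral_Iic_add_Ioi h.integrableOn h.integrableOn).symm
  rw [hankelIntegral, hsplit _ hup, hsplit _ hlow]
  rw [smul_eq_mul] at hzero
  linear_combination hzero

lemma hankelIntegral_hankelKernel_of_lt_one {θ ρ b : ℝ} (hθ : Real.pi / 2 < θ)
    (hθ' : θ ≤ Real.pi) (hb : 0 < b) (hb' : b < 1) :
    hankelIntegral θ ρ (hankelKernel b) = 2 * Real.pi * I * (Real.Gamma (1 - b) : ℂ)⁻¹ := by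
  have hcos : Real.cos θ < 0 :=
    Real.cos_neg_of_pi_div_two_lt_of_lt hθ (by linarith [Real.pi_pos])
  rw [← integral_hankelKernel_sub hθ hθ' hb hb']
  refine hankelIntegral_eq_of_norm_le (C := Real.exp (Real.exp ρ)) (by linarith [Real.pi_pos]) hb
    (fun w _ => differentiable_hankelKernel b w) (fun x y hx _ => ?_)
    (integrable_hankelKernel hcos hb)
    (integrable_hankelKernel (by rwa [Real.cos_neg]) hb)
  rw [norm_hankelKernel, ← Real.exp_add, Real.exp_le_exp]
  have h1 : Real.exp x ≤ Real.exp ρ := Real.exp_le_exp.mpr hx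
  nlinarith [Real.cos_le_one y, Real.exp_pos x]

lemma continuousAt_hankelIntegral_hankelKernel {θ ρ : ℝ} (hθ : Real.cos θ < 0) (hρ : 0 ≤ ρ)
    (b₀ : ℝ) : ContinuousAt (fun b => hankelIntegral θ ρ (hankelKernel b)) b₀ := by
  have hray : ∀ φ : ℝ, Real.cos φ < 0 →
      ContinuousAt (fun b => ∫ x : ℝ in Ioi ρ, hankelKernel b (x + φ * I)) b₀ := fun φ hφ => by
    refine continuousAt_of_dominated
      (Eventually.of_forall fun b => (continuous_hankelKernel_line b φ).aestronglyMeasurable) ?_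
      (integrableOn_hankelKernel hφ hρ (b₀ + 1)).norm
      (Eventually.of_forall fun x => ?_)
    · filter_upwards [eventually_le_nhds (lt_add_one b₀)] with b hb
      filter_upwards [ae_restrict_mem measurableSet_Ioi] with x hx
      exact norm_hankelKernel_le_of_le hb (hρ.trans (le_of_lt hx)) φ
    · unfold hankelKernel
      fun_prop
  have harc : Continuous fun b : ℝ => ∫ y : ℝ in (-θ)..θ, hankelKernel b (ρ + y * I) := by
    refine intervalIntegral.continuous_parametric_intervalIntegral_of_continuous' ?_ _ _
    unfold hankelKernel Function.uncurry
    fun_prop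
  exact ((hray θ hθ).sub (hray (-θ) (by rwa [Real.cos_neg]))).add
    (continuousAt_const.mul harc.continuousAt)

lemma hasDerivAt_hankelKernel (b : ℝ) (w : ℂ) :
    HasDerivAt (hankelKernel b) (hankelKernel (b + 1) w + b * hankelKernel b w) w := by
  have h := (((Complex.hasDerivAt_exp w).add ((hasDerivAt_id w).const_mul (b : ℂ))).cexp)
  convert! h using 1
  rw [hankelKernel_add]
  simp only [hankelKernel, Pi.add_apply, id]
  push_cast
  ring_nf

lemma hankelIntegral_hankelKernel_add_one {θ ρ : ℝ} (hθ : Real.cos θ < 0) (hρ : 0 ≤ ρ) (b : ℝ) :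
    hankelIntegral θ ρ (hankelKernel (b + 1)) = -b * hankelIntegral θ ρ (hankelKernel b) := by
  have hray : ∀ φ : ℝ, Real.cos φ < 0 → (∫ x : ℝ in Ioi ρ, hankelKernel (b + 1) (x + φ * I)) +
      b * (∫ x : ℝ in Ioi ρ, hankelKernel b (x + φ * I)) = -hankelKernel b (ρ + φ * I) :=
    fun φ hφ => by
      have h0 := integrableOn_hankelKernel hφ hρ b
      have h1 := integrableOn_hankelKernel hφ hρ (b + 1)
      have hd : ∀ x : ℝ, HasDerivAt (fun x : ℝ => hankelKernel b (x + φ * I))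
          (hankelKernel (b + 1) (x + φ * I) + b * hankelKernel b (x + φ * I)) x := fun x => by
        have hl : HasDerivAt (fun x : ℝ => (x : ℂ) + φ * I) 1 x := by
          simpa using (hasDerivAt_id x).ofReal_comp.add_const (φ * I)
        convert! (hasDerivAt_hankelKernel b (x + φ * I)).comp x hl using 1
        rw [mul_one]
      rw [← integral_const_mul, ← integral_add h1 (h0.const_mul _),
        integral_Ioi_of_hasDerivAt_of_tendsto' (fun x _ => hd x) (h1.add (h0.const_mul _))
          (tendsto_zero_of_hasDerivAt_of_integrableOn_Ioi (fun x _ => hd x)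
            (h1.add (h0.const_mul _)) h0), zero_sub]
  have hcont : ∀ c : ℝ, Continuous fun y : ℝ => hankelKernel c (ρ + y * I) := fun c =>
    (differentiable_hankelKernel c).continuous.comp (by fun_prop)
  have harc : I * (∫ y : ℝ in (-θ)..θ, hankelKernel (b + 1) (ρ + y * I)) +
      b * (I * ∫ y : ℝ in (-θ)..θ, hankelKernel b (ρ + y * I)) =
      hankelKernel b (ρ + θ * I) - hankelKernel b (ρ + (-θ : ℝ) * I) := by
    have hd : ∀ y : ℝ, HasDerivAt (fun y : ℝ => hankelKernel b (ρ + y * I))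
        (I * hankelKernel (b + 1) (ρ + y * I) + b * (I * hankelKernel b (ρ + y * I))) y :=
      fun y => by
        have hl : HasDerivAt (fun y : ℝ => (ρ : ℂ) + y * I) I y := by
          simpa using ((hasDerivAt_id y).ofReal_comp.mul_const I).const_add (ρ : ℂ)
        convert! (hasDerivAt_hankelKernel b (ρ + y * I)).comp y hl using 1
        ring
    rw [← intervalIntegral.integral_eq_sub_of_hasDerivAt (fun y _ => hd y)
      (Continuous.intervalIntegrable (by have := hcont b; have := hcont (b + 1); fun_prop) _ _),
      intervalIntegral.integral_add
        (((hcont _).const_mul I).intervalIntegrable _ _)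
        ((((hcont _).const_mul I).const_mul _).intervalIntegrable _ _)]
    simp only [intervalIntegral.integral_const_mul]
  simp only [hankelIntegral]
  linear_combination hray θ hθ - hray (-θ) (by rwa [Real.cos_neg]) + harc

/-- **Hankel's formula** for the reciprocal Gamma function. -/
lemma hankelIntegral_hankelKernel {θ ρ s : ℝ} (hθ : Real.pi / 2 < θ) (hθ' : θ ≤ Real.pi)
    (hρ : 0 ≤ ρ) (hs : 0 < s) :
    hankelIntegral θ ρ (hankelKernel (1 - s)) = 2 * Real.pi * I * (Real.Gamma s : ℂ)⁻¹ := by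
  have hcos : Real.cos θ < 0 :=
    Real.cos_neg_of_pi_div_two_lt_of_lt hθ (by linarith [Real.pi_pos])
  have hbase : ∀ b : ℝ, 0 ≤ b → b < 1 → hankelIntegral θ ρ (hankelKernel b) =
      2 * Real.pi * I * (Real.Gamma (1 - b) : ℂ)⁻¹ := fun b hb hb' => by
    rcases hb.eq_or_lt with rfl | hb
    · have hΓ : ContinuousAt
          (fun b : ℝ => 2 * Real.pi * I * (Real.Gamma (1 - b) : ℂ)⁻¹) 0 := by
        have hG : ContinuousAt (fun b : ℝ => Real.Gamma (1 - b)) 0 := by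
          refine ContinuousAt.comp (g := Real.Gamma) ?_ (by fun_prop)
          exact (Real.differentiableOn_Gamma_Ioi.differentiableAt
            (Ioi_mem_nhds (by norm_num))).continuousAt
        exact continuousAt_const.mul
          ((Complex.continuous_ofReal.continuousAt.comp hG).inv₀ (by simp))
      refine tendsto_nhds_unique_of_eventuallyEq (l := 𝓝[>] (0 : ℝ))
        ((continuousAt_hankelIntegral_hankelKernel hcos hρ 0).tendsto.mono_left
          nhdsWithin_le_nhds) (hΓ.tendsto.mono_left nhdsWithin_le_nhds) ?_
      filter_upwards [Ioo_mem_nhdsGT one_pos] with b hb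
      exact hankelIntegral_hankelKernel_of_lt_one hθ hθ' hb.1 hb.2
    · exact hankelIntegral_hankelKernel_of_lt_one hθ hθ' hb hb'
  have hstep : ∀ (n : ℕ) (t : ℝ), 0 < t → t ≤ n + 1 →
      hankelIntegral θ ρ (hankelKernel (1 - t)) = 2 * Real.pi * I * (Real.Gamma t : ℂ)⁻¹ := by
    intro n
    induction n with
    | zero =>
      intro t ht ht'
      rw [hbase (1 - t) (by simpa using ht') (by linarith), sub_sub_cancel]
    | succ n ih =>
      intro t ht ht'
      rcases le_or_gt t 1 with h1 | h1
      · rw [hbase (1 - t) (by linarith) (by linarith), sub_sub_cancel]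
      · have hrec := hankelIntegral_hankelKernel_add_one hcos hρ (1 - t)
        rw [show 1 - t + 1 = 1 - (t - 1) by ring,
          ih (t - 1) (by linarith) (by push_cast at ht'; linarith)] at hrec
        have hΓ : Real.Gamma t = (t - 1) * Real.Gamma (t - 1) := by
          simpa using Real.Gamma_add_one (s := t - 1) (by linarith)
        have ht1 : (t : ℂ) - 1 ≠ 0 := by exact_mod_cast (sub_pos.mpr h1).ne'
        rw [hΓ]
        push_cast at hrec ⊢
        rw [mul_inv, mul_left_comm, hrec]
        field_simp
        ring
  obtain ⟨n, hn⟩ := exists_nat_ge s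
  exact hstep n s hs (by linarith)

lemma hasSum_integral_mul_geometric {ν : Measure ℝ} {u q : ℝ → ℂ} (hu : Integrable u ν)
    (hq : AEStronglyMeasurable q ν) (hq' : ∀ᵐ t ∂ν, ‖q t‖ ≤ 1 / 2) :
    HasSum (fun k : ℕ => ∫ t, u t * q t ^ k ∂ν) (∫ t, u t * (1 - q t)⁻¹ ∂ν) := by
  refine hasSum_integral_of_dominated_convergence (fun k t => ‖u t‖ * (1 / 2) ^ k)
    (fun k => hu.aestronglyMeasurable.mul (hq.pow k)) (fun k => ?_)
    (Eventually.of_forall fun t => summable_geometric_two.mul_left _) ?_ ?_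
  · filter_upwards [hq'] with t ht
    rw [norm_mul, norm_pow]
    gcongr
  · simp only [tsum_mul_left]
    exact hu.norm.mul_const _
  · filter_upwards [hq'] with t ht
    have hlt : ‖q t‖ < 1 := ht.trans_lt (by norm_num)
    exact (hasSum_geometric_of_norm_lt_one hlt).mul_left (u t)

lemma hasSum_hankelIntegral {θ ρ : ℝ} {q : ℂ → ℂ} (hθ0 : 0 ≤ θ) (hθ : Real.cos θ < 0)
    (hρ : 0 ≤ ρ) (hq : Continuous q) (hq' : ∀ x y : ℝ, ρ ≤ x → ‖q (x + y * I)‖ ≤ 1 / 2) :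
    HasSum (fun k : ℕ => hankelIntegral θ ρ fun w => hankelKernel 0 w * q w ^ k)
      (hankelIntegral θ ρ fun w => hankelKernel 0 w * (1 - q w)⁻¹) := by
  have hray : ∀ φ : ℝ, Real.cos φ < 0 → HasSum
      (fun k : ℕ => ∫ x : ℝ in Ioi ρ, hankelKernel 0 (x + φ * I) * q (x + φ * I) ^ k)
      (∫ x : ℝ in Ioi ρ, hankelKernel 0 (x + φ * I) * (1 - q (x + φ * I))⁻¹) := fun φ hφ => by
    refine hasSum_integral_mul_geometric (integrableOn_hankelKernel hφ hρ 0)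
      (hq.comp (by fun_prop)).aestronglyMeasurable ?_
    filter_upwards [ae_restrict_mem measurableSet_Ioi] with x hx
    exact hq' x φ (le_of_lt hx)
  have hcont : Continuous fun y : ℝ => hankelKernel 0 (ρ + y * I) :=
    (differentiable_hankelKernel 0).continuous.comp (by fun_prop)
  have harc : HasSum
      (fun k : ℕ => ∫ y : ℝ in (-θ)..θ, hankelKernel 0 (ρ + y * I) * q (ρ + y * I) ^ k)
      (∫ y : ℝ in (-θ)..θ, hankelKernel 0 (ρ + y * I) * (1 - q (ρ + y * I))⁻¹) := by
    simp only [intervalIntegral.integral_of_le (neg_le_self hθ0)]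
    exact hasSum_integral_mul_geometric (hcont.integrableOn_Ioc)
      (hq.comp (by fun_prop)).aestronglyMeasurable
      (Eventually.of_forall fun y => hq' ρ y le_rfl)
  exact ((hray θ hθ).sub (hray (-θ) (by rwa [Real.cos_neg]))).add (harc.mul_left I)

lemma mittagLeffler_eq_hankelIntegral {a θ ρ : ℝ} {z : ℂ} (ha : 0 < a)
    (hθ : Real.pi / 2 < θ) (hθ' : θ ≤ Real.pi) (hρ : 0 ≤ ρ) (hz : 2 * ‖z‖ ≤ Real.exp (a * ρ)) :
    2 * Real.pi * I * mittagLeffler a 1 z =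
      hankelIntegral θ ρ fun w => hankelKernel a w / (cexp (a * w) - z) := by
  have hcos : Real.cos θ < 0 :=
    Real.cos_neg_of_pi_div_two_lt_of_lt hθ (by linarith [Real.pi_pos])
  have hsum := hasSum_hankelIntegral (q := fun w => z * cexp (-(a * w)))
    (by linarith [Real.pi_pos]) hcos hρ (by fun_prop) (fun x y hx => by
      have h1 : Real.exp (a * ρ) ≤ Real.exp (a * x) := by gcongr
      have h2 : Real.exp (-(a * x)) * Real.exp (a * x) = 1 := by simp [← Real.exp_add]
      rw [norm_mul, Complex.norm_exp]
      simp only [neg_re, mul_re, ofReal_re, add_re, I_re, mul_zero, ofReal_im, I_im, mul_one,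
        sub_self, add_zero, zero_mul, sub_zero]
      nlinarith [Real.exp_pos (-(a * x))])
  have hterm : ∀ k : ℕ, (hankelIntegral θ ρ fun w =>
      hankelKernel 0 w * (z * cexp (-(a * w))) ^ k) =
      2 * Real.pi * I * (z ^ k / (Real.Gamma (k * a + 1) : ℂ)) := fun k => by
    have hfun : (fun w => hankelKernel 0 w * (z * cexp (-(a * w))) ^ k) =
        fun w => z ^ k * hankelKernel (1 - (k * a + 1)) w := by
      ext w
      rw [show 1 - ((k : ℝ) * a + 1) = 0 + -(k * a) by ring, hankelKernel_add, mul_pow,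
        ← Complex.exp_nat_mul]
      push_cast
      ring_nf
    have hlin : (hankelIntegral θ ρ fun w => z ^ k * hankelKernel (1 - (k * a + 1)) w) =
        z ^ k * hankelIntegral θ ρ (hankelKernel (1 - (k * a + 1))) := by
      simp only [hankelIntegral, integral_const_mul, intervalIntegral.integral_const_mul]
      ring
    rw [hfun, hlin, hankelIntegral_hankelKernel hθ hθ' hρ (by positivity)]
    ring
  have hlim : (fun w => hankelKernel 0 w * (1 - z * cexp (-(a * w)))⁻¹) =
      fun w => hankelKernel a w / (cexp (a * w) - z) := by
    ext w
    have h : cexp (a * w) - z = cexp (a * w) * (1 - z * cexp (-(a * w))) := by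
      rw [mul_sub, mul_left_comm, ← Complex.exp_add]
      simp
    have hk : hankelKernel a w = hankelKernel 0 w * cexp (a * w) := by
      rw [← hankelKernel_add, zero_add]
    rw [h, hk, mul_comm (cexp _), mul_div_mul_right _ _ (Complex.exp_ne_zero _), div_eq_mul_inv]
  simp only [hterm, hlim] at hsum
  rw [mittagLeffler, ← tsum_mul_left]
  exact hsum.tsum_eq

lemma cos_arg_sub_le {z : ℂ} {μ β φ : ℝ} (hβμ : β ≤ μ) (hμ : μ ≤ Real.pi)
    (hz : μ ≤ |z.arg|) (hφ : |φ| ≤ β) : Real.cos (z.arg - φ) ≤ Real.cos (μ - β) := by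
  have harg := Complex.abs_arg_le_pi z
  have hβ : 0 ≤ β := (abs_nonneg φ).trans hφ
  have hlow : μ - β ≤ |z.arg - φ| := by linarith [abs_sub_abs_le_abs_sub z.arg φ]
  have hup : |z.arg - φ| ≤ Real.pi + β := by linarith [abs_sub z.arg φ]
  rw [← Real.cos_abs (z.arg - φ)]
  rcases le_total |z.arg - φ| Real.pi with h | h
  · exact Real.cos_le_cos_of_nonneg_of_le_pi (by linarith) h hlow
  · rw [← Real.cos_two_pi_sub]
    exact Real.cos_le_cos_of_nonneg_of_le_pi (by linarith) (by linarith) (by linarith)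

lemma sin_mul_norm_le_norm_exp_sub {z : ℂ} {a μ θ x y : ℝ} (ha : 0 ≤ a) (hθμ : a * θ ≤ μ)
    (hμ : μ ≤ Real.pi) (hz : μ ≤ |z.arg|) (hy : |y| ≤ θ) :
    Real.sin (μ - a * θ) * ‖z‖ ≤ ‖cexp (a * (x + y * I)) - z‖ := by
  set k := Real.cos (μ - a * θ) with hk
  set s := Real.sin (μ - a * θ) with hs
  have hcos : Real.cos (z.arg - a * y) ≤ k :=
    cos_arg_sub_le hθμ hμ hz (by rw [abs_mul, abs_of_nonneg ha]; gcongr)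
  have hsk : s ^ 2 + k ^ 2 = 1 := Real.sin_sq_add_cos_sq _
  have hre : (cexp (a * (x + y * I))).re = Real.exp (a * x) * Real.cos (a * y) := by
    simp [Complex.exp_re]
  have him : (cexp (a * (x + y * I))).im = Real.exp (a * x) * Real.sin (a * y) := by
    simp [Complex.exp_im]
  have hzre := Complex.norm_mul_cos_arg z
  have hzim := Complex.norm_mul_sin_arg z
  refine abs_le_of_sq_le_sq' ?_ (norm_nonneg _) |>.2
  rw [Complex.sq_norm, Complex.normSq_apply, sub_re, sub_im, hre, him, ← hzre, ← hzim]
  rw [Real.cos_sub] at hcos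
  set r := Real.exp (a * x)
  have hr : 0 < r := Real.exp_pos _
  have hmul := mul_le_mul_of_nonneg_left hcos (mul_nonneg hr.le (norm_nonneg z))
  have hsq : (s * ‖z‖) ^ 2 = ‖z‖ ^ 2 - (‖z‖ * k) ^ 2 := by linear_combination ‖z‖ ^ 2 * hsk
  rw [hsq]
  linear_combination 2 * hmul + sq_nonneg (r - ‖z‖ * k) -
    r ^ 2 * Real.sin_sq_add_cos_sq (a * y) - ‖z‖ ^ 2 * Real.sin_sq_add_cos_sq z.arg

section Line

variable {a b φ m : ℝ} {z : ℂ}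

lemma norm_hankelKernel_div_le (hm : 0 < m) (hz : ∀ x : ℝ, m ≤ ‖cexp (a * (x + φ * I)) - z‖)
    (x : ℝ) : ‖hankelKernel b (x + φ * I) / (cexp (a * (x + φ * I)) - z)‖ ≤
      ‖hankelKernel b (x + φ * I)‖ / m := by
  rw [norm_div]
  gcongr
  exact hz x

lemma integrable_hankelKernel_div (hφ : Real.cos φ < 0) (hb : 0 < b) (hm : 0 < m)
    (hz : ∀ x : ℝ, m ≤ ‖cexp (a * (x + φ * I)) - z‖) :
    Integrable fun x : ℝ => hankelKernel b (x + φ * I) / (cexp (a * (x + φ * I)) - z) := by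
  refine ((integrable_hankelKernel hφ hb).norm.div_const m).mono' ?_
    (Eventually.of_forall (norm_hankelKernel_div_le hm hz))
  exact ((continuous_hankelKernel_line b φ).div (by fun_prop)
    fun x => norm_pos_iff.mp (hm.trans_le (hz x))).aestronglyMeasurable

lemma norm_integral_hankelKernel_div_le (hφ : Real.cos φ < 0) (hb : 0 < b) (hm : 0 < m)
    (hz : ∀ x : ℝ, m ≤ ‖cexp (a * (x + φ * I)) - z‖) :
    ‖∫ x : ℝ, hankelKernel b (x + φ * I) / (cexp (a * (x + φ * I)) - z)‖ ≤
      (∫ x : ℝ, ‖hankelKernel b (x + φ * I)‖) / m := by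
  rw [← integral_div]
  exact norm_integral_le_of_norm_le ((integrable_hankelKernel hφ hb).norm.div_const m)
    (Eventually.of_forall (norm_hankelKernel_div_le hm hz))

lemma integral_hankelKernel_div (hφ : Real.cos φ < 0) (ha : 0 < a) (hz0 : z ≠ 0) (hm : 0 < m)
    (hz : ∀ x : ℝ, m ≤ ‖cexp (a * (x + φ * I)) - z‖) :
    ∫ x : ℝ, hankelKernel a (x + φ * I) / (cexp (a * (x + φ * I)) - z) =
      z⁻¹ * (∫ x : ℝ, hankelKernel (a + a) (x + φ * I) / (cexp (a * (x + φ * I)) - z)) -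
        z⁻¹ * ∫ x : ℝ, hankelKernel a (x + φ * I) := by
  rw [← integral_const_mul, ← integral_const_mul, ← integral_sub
    ((integrable_hankelKernel_div hφ (add_pos ha ha) hm hz).const_mul _)
    ((integrable_hankelKernel hφ ha).const_mul _)]
  congr 1 with x
  have hne : cexp (a * (x + φ * I)) - z ≠ 0 := norm_pos_iff.mp (hm.trans_le (hz x))
  rw [hankelKernel_add]
  generalize cexp (a * (x + φ * I)) = e at hne ⊢
  field_simp
  ring

end Line

/-- The Mittag–Leffler function as an integral over the two rays `arg ζ = ±θ`. -/
lemma mittagLeffler_eq_integral_sub {a μ θ : ℝ} {z : ℂ} (ha : 0 < a) (hθ : Real.pi / 2 < θ)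
    (hθ' : θ ≤ Real.pi) (hθμ : a * θ < μ) (hμ : μ ≤ Real.pi) (hz1 : 1 ≤ ‖z‖)
    (hz : μ ≤ |z.arg|) :
    2 * Real.pi * I * mittagLeffler a 1 z =
      (∫ x : ℝ, hankelKernel a (x + θ * I) / (cexp (a * (x + θ * I)) - z)) -
        ∫ x : ℝ, hankelKernel a (x + (-θ : ℝ) * I) / (cexp (a * (x + (-θ : ℝ) * I)) - z) := by
  have hπ := Real.pi_pos
  have hcos : Real.cos θ < 0 := Real.cos_neg_of_pi_div_two_lt_of_lt hθ (by linarith)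
  have hm : 0 < Real.sin (μ - a * θ) * ‖z‖ :=
    mul_pos (Real.sin_pos_of_pos_of_lt_pi (by linarith) (by nlinarith)) (by linarith)
  have hdist : ∀ x y : ℝ, |y| ≤ θ →
      Real.sin (μ - a * θ) * ‖z‖ ≤ ‖cexp (a * (x + y * I)) - z‖ := fun x y hy =>
    sin_mul_norm_le_norm_exp_sub ha.le hθμ.le hμ hz hy
  have hθabs : |θ| ≤ θ := (abs_of_pos (by linarith)).le
  have hρ : 2 * ‖z‖ ≤ Real.exp (a * (Real.log (2 * ‖z‖) / a)) := by
    rw [mul_div_cancel₀ _ ha.ne', Real.exp_log (by linarith)]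
  rw [mittagLeffler_eq_hankelIntegral ha hθ hθ'
    (div_nonneg (Real.log_nonneg (by linarith)) ha.le) hρ]
  set ρ := Real.log (2 * ‖z‖) / a
  refine hankelIntegral_eq_of_norm_le
    (C := Real.exp (Real.exp ρ) / (Real.sin (μ - a * θ) * ‖z‖)) (by linarith) ha
    (fun w hw => ?_) (fun x y hx hy => ?_)
    (integrable_hankelKernel_div hcos ha hm fun x => hdist x θ hθabs)
    (integrable_hankelKernel_div (by rwa [Real.cos_neg]) ha hm
      fun x => hdist x (-θ) (by rwa [abs_neg]))
  · have hw' := hdist w.re w.im hw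
    rw [re_add_im] at hw'
    exact (differentiable_hankelKernel a w).div (by fun_prop)
      (norm_pos_iff.mp (hm.trans_le hw'))
  · rw [norm_div, div_mul_eq_mul_div]
    have hker : ‖hankelKernel a (x + y * I)‖ ≤ Real.exp (Real.exp ρ) * Real.exp (a * x) := by
      rw [norm_hankelKernel, ← Real.exp_add, Real.exp_le_exp]
      have h1 : Real.exp x ≤ Real.exp ρ := Real.exp_le_exp.mpr hx
      nlinarith [Real.cos_le_one y, Real.exp_pos x]
    gcongr
    exact hdist x y hy

end MittagLeffler

open MittagLeffler Complex MeasureTheory in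
/-- If `0 < a < 1` and `πa/2 < μ < πa`, then `E_{a,1}(z) = -z⁻¹/Γ(1-a) + O(|z|⁻²)` as
`|z| → ∞` in the sector `μ ≤ |arg z| ≤ π`. -/
theorem mittagLeffler_asymptotic_in_sector (a mu : ℝ) (ha0 : 0 < a) (ha1 : a < 1)
    (hmu1 : Real.pi * a / 2 < mu) (hmu2 : mu < Real.pi * a) :
    ∃ C > 0, ∃ R > 0, ∀ z : ℂ, R ≤ ‖z‖ → mu ≤ |z.arg| → |z.arg| ≤ Real.pi →
      ‖mittagLeffler a 1 z + z⁻¹ / (Real.Gamma (1 - a) : ℂ)‖ ≤ C / ‖z‖ ^ 2 := by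
  have hπ := Real.pi_pos
  have hmuπ : mu ≤ Real.pi := by nlinarith
  obtain ⟨θ, hθ, hθ'⟩ : ∃ θ, Real.pi / 2 < θ ∧ θ < mu / a :=
    exists_between ((lt_div_iff₀ ha0).mpr (by linarith))
  have hθμ : a * θ < mu := by rwa [lt_div_iff₀' ha0] at hθ'
  have hθπ : θ ≤ Real.pi := hθ'.le.trans ((div_le_iff₀ ha0).mpr hmu2.le)
  have hcos : Real.cos θ < 0 := Real.cos_neg_of_pi_div_two_lt_of_lt hθ (by linarith)
  have hcos' : Real.cos (-θ) < 0 := by rwa [Real.cos_neg]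
  have hs : 0 < Real.sin (mu - a * θ) :=
    Real.sin_pos_of_pos_of_lt_pi (by linarith) (by nlinarith)
  set s := Real.sin (mu - a * θ)
  set K := (∫ x : ℝ, ‖hankelKernel (a + a) (x + θ * I)‖) +
    ∫ x : ℝ, ‖hankelKernel (a + a) (x + (-θ : ℝ) * I)‖
  have hK : 0 ≤ K := by positivity
  refine ⟨K / (2 * Real.pi * s) + 1, by positivity, 1, one_pos, fun z hz1 hz _ => ?_⟩
  have hzpos : 0 < ‖z‖ := by linarith
  have hz0 : z ≠ 0 := norm_pos_iff.mp hzpos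
  have hm : 0 < s * ‖z‖ := mul_pos hs hzpos
  have hup : ∀ x : ℝ, s * ‖z‖ ≤ ‖cexp (a * (x + θ * I)) - z‖ := fun x =>
    sin_mul_norm_le_norm_exp_sub ha0.le hθμ.le hmuπ hz (abs_of_pos (by linarith)).le
  have hlow : ∀ x : ℝ, s * ‖z‖ ≤ ‖cexp (a * (x + (-θ : ℝ) * I)) - z‖ := fun x =>
    sin_mul_norm_le_norm_exp_sub ha0.le hθμ.le hmuπ hz
      (by rw [abs_neg]; exact (abs_of_pos (by linarith)).le)
  have hE := mittagLeffler_eq_integral_sub ha0 hθ hθπ hθμ hmuπ hz1 hz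
  rw [integral_hankelKernel_div hcos ha0 hz0 hm hup,
    integral_hankelKernel_div hcos' ha0 hz0 hm hlow] at hE
  have hupper := norm_integral_hankelKernel_div_le hcos (add_pos ha0 ha0) hm hup
  have hlower := norm_integral_hankelKernel_div_le hcos' (add_pos ha0 ha0) hm hlow
  set U := ∫ x : ℝ, hankelKernel (a + a) (x + θ * I) / (cexp (a * (x + θ * I)) - z)
  set L := ∫ x : ℝ,
    hankelKernel (a + a) (x + (-θ : ℝ) * I) / (cexp (a * (x + (-θ : ℝ) * I)) - z)
  have hmain : 2 * Real.pi * I * (mittagLeffler a 1 z + z⁻¹ / (Real.Gamma (1 - a) : ℂ)) =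
      z⁻¹ * (U - L) := by
    rw [div_eq_mul_inv]
    linear_combination hE - z⁻¹ * integral_hankelKernel_sub hθ hθπ ha0 ha1
  have hUL : ‖U - L‖ ≤ K / (s * ‖z‖) := by
    rw [add_div]
    exact (norm_sub_le U L).trans (add_le_add hupper hlower)
  have hnorm := congrArg norm hmain
  have h2π : ‖(2 * Real.pi * I : ℂ)‖ = 2 * Real.pi := by simp [abs_of_pos hπ]
  rw [norm_mul (2 * Real.pi * I), h2π, norm_mul, norm_inv] at hnorm
  calc ‖mittagLeffler a 1 z + z⁻¹ / (Real.Gamma (1 - a) : ℂ)‖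
      = ‖z‖⁻¹ * ‖U - L‖ / (2 * Real.pi) := by rw [← hnorm]; field_simp
    _ ≤ ‖z‖⁻¹ * (K / (s * ‖z‖)) / (2 * Real.pi) := by gcongr
    _ = K / (2 * Real.pi * s) / ‖z‖ ^ 2 := by field_simp
    _ ≤ (K / (2 * Real.pi * s) + 1) / ‖z‖ ^ 2 := by gcongr; linarith
end
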